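/- arXiv:1207.3517 — 3 statements merged into one kernel-verified Lean document; each statement's English description precedes it below -/
import Mathlib

section
/- Let ν be a probability measure on l²(ℕ) satisfying Hyp(X, H, α) for some Hilbert space X, H ∈ l²(ℕ)⊗X and α ≥ 0. Then: (a) if α > 0, ρ_3(ν, m_β) ≤ (1/2)·‖trace_X(H⊗H) − S_β‖_{𝒮₁} + α/3; (b) if α = 0, ρ_2(ν, m_β) ≤ (1/2)·‖trace_X(H⊗H) − S_β‖_{𝒮₁}, where ‖·‖_{𝒮₁} is the trace (Schatten-1) norm on operators of l²(ℕ). -/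
/- Statement 10: Abstract Stein method bound. If ν satisfies Hyp(X, H, α) then
ρ_3(ν, m_β) ≤ (1/2)‖trace_X(H⊗H) − S_β‖_{𝒮₁} + α/3 when α > 0, and
ρ_2(ν, m_β) ≤ (1/2)‖trace_X(H⊗H) − S_β‖_{𝒮₁} when α = 0. -/

open MeasureTheory ProbabilityTheory Filter
open scoped ENNReal NNReal RealInnerProductSpace Classical

noncomputable section

abbrev l2 : Type := lp (fun _ : ℕ => ℝ) 2
instance : MeasurableSpace l2 := borel l2
instance : BorelSpace l2 := ⟨rfl⟩

/-- The canonical orthonormal basis vectors of l²(ℕ). -/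
def xb (n : ℕ) : l2 := lp.single 2 n 1

abbrev μ01 : Measure ℝ := volume.restrict (Set.Icc (0:ℝ) 1)
abbrev L2 : Type := MeasureTheory.Lp ℝ 2 μ01

/-- The right-sided Riemann–Liouville fractional integral of order 1−β (pointwise). -/
def Ifrac (β : ℝ) (f : ℝ → ℝ) (x : ℝ) : ℝ :=
  (1 / Real.Gamma (1 - β)) * ∫ t in Set.Ioc x 1, f t * (t - x) ^ (-β)

/-- The distance ρ_j built on test functions of class C^j_b with norm at most 1. -/
def rho (j : ℕ) (ν μ : Measure l2) : ℝ :=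
  sSup { r : ℝ | ∃ F : l2 → ℝ, ContDiff ℝ j F ∧
    (∀ i : ℕ, 1 ≤ i → i ≤ j → ∀ x, ‖iteratedFDeriv ℝ i F x‖ ≤ 1) ∧
    r = (∫ x, F x ∂ν) - ∫ x, F x ∂μ }

/-- The trace (Schatten-1) norm of an operator on l²(ℕ), via the classical
characterization ‖A‖_{𝒮₁} = sup_{(e),(f) orthonormal bases} Σ_n |⟨A e_n, f_n⟩|. -/
def traceNormE (A : l2 →L[ℝ] l2) : ℝ≥0∞ :=
  ⨆ (e : HilbertBasis ℕ ℝ l2) (f : HilbertBasis ℕ ℝ l2),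
    ∑' n, (‖⟪A (e n), f n⟫‖₊ : ℝ≥0∞)

/-- The measure ν satisfies Hyp(X, H, α): for every G ∈ C²_b(l²(ℕ); l²(ℕ)),
|∫ x·G(x) dν − ∫ trace(trace_X(H⊗H)∘∇G(x)) dν| ≤ α·‖∇^{(2)}G‖_∞, where H ∈ l²(ℕ)⊗X is
identified with the family (H_n)_n of its X-valued coordinates, so that the partial
trace trace_X(H⊗H) has matrix entries ⟨H_n, H_k⟩_X. -/
def SteinHyp {X : Type*} [NormedAddCommGroup X] [InnerProductSpace ℝ X]
    (ν : Measure l2) (H : ℕ → X) (α : ℝ) : Prop :=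
  ∀ G : l2 → l2, ContDiff ℝ 2 G →
    (∃ C1, ∀ x, ‖fderiv ℝ G x‖ ≤ C1) →
    ∀ C2 : ℝ, (∀ x, ‖iteratedFDeriv ℝ 2 G x‖ ≤ C2) →
    |(∫ x, ⟪x, G x⟫ ∂ν)
        - ∫ x, ∑' n, ∑' k, ⟪H n, H k⟫ * (↑(fderiv ℝ G x (xb n)) : ∀ _ : ℕ, ℝ) k ∂ν|
      ≤ α * C2

lemma hasDerivAt_gaussianPDFReal (x : ℝ) :
    HasDerivAt (gaussianPDFReal 0 1) (-(x * gaussianPDFReal 0 1 x)) x := by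
  have h1 : HasDerivAt (fun y : ℝ => -(y - 0) ^ 2 / (2 * ((1 : ℝ≥0) : ℝ))) (-x) x := by
    have := ((((hasDerivAt_id x).sub_const 0).pow 2).neg).div_const (2 * ((1 : ℝ≥0) : ℝ))
    refine this.congr_deriv ?_
    simp
    ring
  have h2 := h1.exp.const_mul (√(2 * Real.pi * (1 : ℝ≥0)))⁻¹
  rw [gaussianPDFReal_def]
  refine h2.congr_deriv ?_
  ring

/-- Stein's lemma for the standard normal distribution. -/
lemma integral_mul_gaussianReal {u u' : ℝ → ℝ} (hu : ∀ x, HasDerivAt u (u' x) x)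
    {C C' : ℝ} (hC : ∀ x, |u x| ≤ C) (hC' : ∀ x, |u' x| ≤ C') (hc : Continuous u') :
    ∫ t, t * u t ∂(gaussianReal 0 1) = ∫ t, u' t ∂(gaussianReal 0 1) := by
  have hint : Integrable (gaussianPDFReal 0 1) := integrable_gaussianPDFReal 0 1
  have huc : Continuous u := continuous_iff_continuousAt.2 fun x => (hu x).continuousAt
  have hpdf : Continuous (gaussianPDFReal 0 1) :=
    continuous_iff_continuousAt.2 fun x => (hasDerivAt_gaussianPDFReal x).continuousAt
  have hint1 : Integrable (fun x => x * gaussianPDFReal 0 1 x) := by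
    have h := (IsGaussian.integrable_id (μ := gaussianReal 0 1))
    rw [gaussianReal_of_var_ne_zero _ one_ne_zero,
      integrable_withDensity_iff_integrable_smul' (measurable_gaussianPDF _ _)
        (ae_of_all _ fun _ ↦ gaussianPDF_lt_top)] at h
    refine h.congr (ae_of_all _ fun x => ?_)
    simp [mul_comm]
  have key := integral_mul_deriv_eq_deriv_mul_of_integrable (u := u) (v := gaussianPDFReal 0 1)
    (fun x _ => hu x) (fun x _ => hasDerivAt_gaussianPDFReal x)
    (by
      refine hint1.neg.bdd_mul (c := C) huc.aestronglyMeasurable (ae_of_all _ hC))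
    (hint.bdd_mul (c := C') hc.aestronglyMeasurable (ae_of_all _ hC'))
    (hint.bdd_mul (c := C) huc.aestronglyMeasurable (ae_of_all _ hC))
  rw [integral_gaussianReal_eq_integral_smul one_ne_zero,
    integral_gaussianReal_eq_integral_smul one_ne_zero]
  have e1 : ∫ x, gaussianPDFReal 0 1 x • (x * u x)
      = -∫ x, u x * -(x * gaussianPDFReal 0 1 x) := by
    rw [← integral_neg]; congr with x; simp; ring
  rw [e1, key, neg_neg]
  congr with x; simp; ring

section GaussianIBP

variable {E W : Type*} [NormedAddCommGroup E] [InnerProductSpace ℝ E]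
  [SecondCountableTopology E] [MeasurableSpace E] [BorelSpace E]
  [NormedAddCommGroup W] [InnerProductSpace ℝ W]

lemma ae_inner_eq_zero_of_charFun {μ : Measure E} [IsProbabilityMeasure μ] (L : E →ₗ[ℝ] W)
    (hμ : ∀ v, charFun μ v = Complex.exp (-((‖L v‖ ^ 2 / 2 : ℝ) : ℂ)))
    {v : E} (hv : L v = 0) : ∀ᵐ y ∂μ, ⟪v, y⟫ = 0 := by
  have hm : Measurable (fun y : E => ⟪v, y⟫) := by fun_prop
  have : IsProbabilityMeasure (μ.map (fun y : E => ⟪v, y⟫)) :=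
    Measure.isProbabilityMeasure_map hm.aemeasurable
  have h : μ.map (fun y : E => ⟪v, y⟫) = Measure.dirac 0 := by
    apply Measure.ext_of_charFun
    ext t
    rw [charFun_apply, integral_map hm.aemeasurable (by fun_prop), charFun_dirac]
    have := hμ (t • v)
    rw [charFun_apply, map_smul, hv] at this
    simp only [smul_zero, norm_zero] at this
    simp only [inner_zero_left, Complex.ofReal_zero, zero_mul, Complex.exp_zero]
    rw [show (1 : ℂ) = Complex.exp (-(((0:ℝ) ^ 2 / 2 : ℝ) : ℂ)) by simp, ← this]
    congr with y
    simp [inner_smul_right, real_inner_comm v y]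
  have h2 : ∀ᵐ t ∂(μ.map (fun y : E => ⟪v, y⟫)), t = 0 := by
    rw [h]; simp [ae_dirac_eq]
  exact ae_of_ae_map hm.aemeasurable h2

variable [CompleteSpace E]

/-- A centered Gaussian measure splits along the direction `v` into a one-dimensional Gaussian
factor and an independent remainder. -/
lemma map_prod_gaussianReal_eq {μ : Measure E} [IsProbabilityMeasure μ] (L : E →ₗ[ℝ] W)
    (hμ : ∀ v, charFun μ v = Complex.exp (-((‖L v‖ ^ 2 / 2 : ℝ) : ℂ)))
    {v w : E} (hw : ∀ z, ⟪w, z⟫ = ⟪L v, L z⟫) (hv : L v ≠ 0) :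
    ((gaussianReal 0 1).prod μ).map
      (fun p => (p.1 / ‖L v‖) • w + (p.2 - (⟪v, p.2⟫ / ‖L v‖ ^ 2) • w)) = μ := by
  have hs : ‖L v‖ ≠ 0 := norm_ne_zero_iff.2 hv
  have hmeas : Continuous
      (fun p : ℝ × E => (p.1 / ‖L v‖) • w + (p.2 - (⟪v, p.2⟫ / ‖L v‖ ^ 2) • w)) := by fun_prop
  have : IsProbabilityMeasure (((gaussianReal 0 1).prod μ).map
      (fun p => (p.1 / ‖L v‖) • w + (p.2 - (⟪v, p.2⟫ / ‖L v‖ ^ 2) • w))) :=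
    Measure.isProbabilityMeasure_map hmeas.aemeasurable
  apply Measure.ext_of_charFun
  ext z
  rw [charFun_apply, integral_map hmeas.aemeasurable (by fun_prop)]
  have e : ∀ p : ℝ × E, Complex.exp
      (⟪(p.1 / ‖L v‖) • w + (p.2 - (⟪v, p.2⟫ / ‖L v‖ ^ 2) • w), z⟫ * Complex.I)
      = Complex.exp (⟪p.1, ⟪w, z⟫ / ‖L v‖⟫ * Complex.I)
        * Complex.exp (⟪p.2, z - (⟪w, z⟫ / ‖L v‖ ^ 2) • v⟫ * Complex.I) := by
    intro p
    rw [← Complex.exp_add, ← add_mul, ← Complex.ofReal_add]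
    congr 3
    simp only [inner_add_left, inner_sub_left, inner_smul_left, inner_sub_right, inner_smul_right,
      real_inner_comm v p.2]
    simp
    ring
  simp_rw [e]
  rw [integral_prod_mul (μ := gaussianReal 0 1) (ν := μ)
    (fun t : ℝ => Complex.exp (⟪t, ⟪w, z⟫ / ‖L v‖⟫ * Complex.I))
    (fun y : E => Complex.exp (⟪y, z - (⟪w, z⟫ / ‖L v‖ ^ 2) • v⟫ * Complex.I)),
    ← charFun_apply, ← charFun_apply, charFun_gaussianReal, hμ, hμ, ← Complex.exp_add]
  have hn : ‖L (z - (⟪w, z⟫ / ‖L v‖ ^ 2) • v)‖ ^ 2 = ‖L z‖ ^ 2 - (⟪w, z⟫ / ‖L v‖) ^ 2 := by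
    rw [map_sub, map_smul, norm_sub_sq_real, inner_smul_right, real_inner_comm (L v) (L z),
      ← hw z, norm_smul, Real.norm_eq_abs, mul_pow, sq_abs]
    field_simp
    ring
  rw [hn]
  congr 1
  push_cast
  ring

/-- Gaussian integration by parts. -/
lemma integral_inner_mul_gaussian {μ : Measure E} [IsProbabilityMeasure μ] (L : E →ₗ[ℝ] W)
    (hμ : ∀ v, charFun μ v = Complex.exp (-((‖L v‖ ^ 2 / 2 : ℝ) : ℂ)))
    (hid : Integrable id μ)
    {v w : E} (hw : ∀ z, ⟪w, z⟫ = ⟪L v, L z⟫)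
    {u : E → ℝ} (hu : ContDiff ℝ 1 u) {C C' : ℝ} (hC : ∀ x, |u x| ≤ C)
    (hC' : ∀ x, ‖fderiv ℝ u x‖ ≤ C') :
    ∫ y, ⟪v, y⟫ * u y ∂μ = ∫ y, fderiv ℝ u y w ∂μ := by
  have hu' : Continuous (fderiv ℝ u) := hu.continuous_fderiv one_ne_zero
  have huc : Continuous u := hu.continuous
  by_cases hv : L v = 0
  · have hw0 : w = 0 := by
      rw [← inner_self_eq_zero (𝕜 := ℝ), hw, hv, inner_zero_left]
    rw [integral_congr_ae (g := fun _ => 0)]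
    · simp [hw0]
    · filter_upwards [ae_inner_eq_zero_of_charFun L hμ hv] with y hy
      simp [hy]
  have hs : ‖L v‖ ≠ 0 := norm_ne_zero_iff.2 hv
  set s := ‖L v‖ with hsdef
  set φ : ℝ × E → E := fun p => (p.1 / s) • w + (p.2 - (⟪v, p.2⟫ / s ^ 2) • w) with hφ
  have hφc : Continuous φ := by fun_prop
  have hmap : ((gaussianReal 0 1).prod μ).map φ = μ := map_prod_gaussianReal_eq L hμ hw hv
  have hvw : ⟪v, w⟫ = s ^ 2 := by rw [real_inner_comm, hw, real_inner_self_eq_norm_sq]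
  have hvφ : ∀ p, ⟪v, φ p⟫ = s * p.1 := by
    intro p
    simp only [hφ, inner_add_right, inner_sub_right, inner_smul_right, hvw]
    field_simp
    ring
  have hi1 : Integrable (fun y => ⟪v, y⟫ * u y) μ := by
    refine Integrable.mul_bdd (c := C) ?_ huc.aestronglyMeasurable (ae_of_all _ hC)
    exact hid.const_inner v
  have hi2 : Integrable (fun y => fderiv ℝ u y w) μ := by
    refine Integrable.of_bound (by fun_prop) (C' * ‖w‖) (ae_of_all _ fun y => ?_)
    exact ((fderiv ℝ u y).le_opNorm w).trans (by gcongr; exact hC' y)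
  have hφmp : MeasurePreserving φ ((gaussianReal 0 1).prod μ) μ := ⟨hφc.measurable, hmap⟩
  have e1 : ∫ y, ⟪v, y⟫ * u y ∂μ
      = ∫ p, (s * p.1) * u (φ p) ∂((gaussianReal 0 1).prod μ) := by
    conv_lhs => rw [← hmap]
    rw [integral_map hφc.aemeasurable (by fun_prop)]
    simp_rw [hvφ]
  have e2 : ∫ y, fderiv ℝ u y w ∂μ
      = ∫ p, fderiv ℝ u (φ p) w ∂((gaussianReal 0 1).prod μ) := by
    conv_lhs => rw [← hmap]
    rw [integral_map hφc.aemeasurable (by fun_prop)]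
  have hj1 : Integrable (fun p : ℝ × E => (s * p.1) * u (φ p)) ((gaussianReal 0 1).prod μ) := by
    have := hφmp.integrable_comp_of_integrable hi1
    refine this.congr (ae_of_all _ fun p => ?_)
    simp [hvφ]
  have hj2 : Integrable (fun p : ℝ × E => fderiv ℝ u (φ p) w) ((gaussianReal 0 1).prod μ) :=
    hφmp.integrable_comp_of_integrable hi2
  rw [e1, e2, integral_prod_symm _ hj1, integral_prod_symm _ hj2]
  congr with y
  have hd : ∀ t, HasDerivAt (fun t => s * u (φ (t, y))) (fderiv ℝ u (φ (t, y)) w) t := by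
    intro t
    have h1 : HasDerivAt (fun t => φ (t, y)) ((1 / s) • w) t :=
      (((hasDerivAt_id t).div_const s).smul_const w).add_const (y - (⟪v, y⟫ / s ^ 2) • w)
    have h2 := ((hu.differentiable one_ne_zero (φ (t, y))).hasFDerivAt.comp_hasDerivAt t
      h1).const_mul s
    refine h2.congr_deriv ?_
    rw [map_smul, smul_eq_mul]
    field_simp
  have h0 : 0 ≤ C := (abs_nonneg _).trans (hC 0)
  rw [← integral_mul_gaussianReal hd (C := |s| * C) (C' := C' * ‖w‖)]
  · congr with t; ring
  · intro t
    rw [abs_mul]; gcongr; exact hC _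
  · intro t
    exact ((fderiv ℝ u _).le_opNorm w).trans (by gcongr; exact hC' _)
  · fun_prop

end GaussianIBP

lemma abs_integral_le_of_forall_le {Ω : Type*} [MeasurableSpace Ω] {μ : Measure Ω}
    [IsProbabilityMeasure μ] {f : Ω → ℝ} {C : ℝ} (h : ∀ x, |f x| ≤ C) : |∫ x, f x ∂μ| ≤ C := by
  simpa using norm_integral_le_of_norm_le_const (f := f) (C := C) (ae_of_all μ h)

section Interpolation

variable {E : Type*} [NormedAddCommGroup E] [InnerProductSpace ℝ E]

lemma norm_iteratedFDeriv_comp_right_le {F G : Type*} [NormedAddCommGroup F] [NormedSpace ℝ F]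
    [NormedAddCommGroup G] [NormedSpace ℝ G] {g : F → G} {n : ℕ} (hg : ContDiff ℝ n g)
    (M : E →L[ℝ] F) (x : E) :
    ‖iteratedFDeriv ℝ n (g ∘ M) x‖ ≤ ‖iteratedFDeriv ℝ n g (M x)‖ * ‖M‖ ^ n := by
  rw [M.iteratedFDeriv_comp_right hg x le_rfl]
  refine (ContinuousMultilinearMap.norm_compContinuousLinearMap_le _ _).trans ?_
  simp

lemma norm_iteratedFDeriv_comp_smul_add_le {F : Type*} [NormedAddCommGroup F] [NormedSpace ℝ F]
    {g : E → F} {n : ℕ} (hg : ContDiff ℝ n g) {C : ℝ} (hC : ∀ x, ‖iteratedFDeriv ℝ n g x‖ ≤ C)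
    (a : ℝ) (c : E) (x : E) :
    ‖iteratedFDeriv ℝ n (fun x => g (a • x + c)) x‖ ≤ |a| ^ n * C := by
  have hg' : ContDiff ℝ n (fun y => g (y + c)) := hg.comp (by fun_prop)
  refine (norm_iteratedFDeriv_comp_right_le hg' (a • ContinuousLinearMap.id ℝ E) x).trans ?_
  rw [iteratedFDeriv_comp_add_right, mul_comm]
  have h1 : ‖a • ContinuousLinearMap.id ℝ E‖ ≤ |a| := by
    rw [norm_smul]
    exact mul_le_of_le_one_right (norm_nonneg _) ContinuousLinearMap.norm_id_le
  have h2 := hC (a • x + c)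
  have h3 : 0 ≤ C := (norm_nonneg _).trans h2
  exact mul_le_mul (pow_le_pow_left₀ (norm_nonneg _) h1 n) h2 (norm_nonneg _) (by positivity)

lemma fderiv_comp_smul_add {F : Type*} [NormedAddCommGroup F] [NormedSpace ℝ F]
    {g : E → F} (hg : Differentiable ℝ g) (a : ℝ) (c x : E) :
    fderiv ℝ (fun x => g (a • x + c)) x = a • fderiv ℝ g (a • x + c) := by
  have h1 : HasFDerivAt (fun x : E => a • x + c) (a • ContinuousLinearMap.id ℝ E) x :=
    ((hasFDerivAt_id x).const_smul a).add_const c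
  have h2 : HasFDerivAt (fun x => g (a • x + c)) _ x := (hg (a • x + c)).hasFDerivAt.comp x h1
  rw [h2.fderiv]
  ext; simp

variable [SecondCountableTopology E] [MeasurableSpace E] [BorelSpace E]

lemma abs_integral_interpolation_deriv_le {ν μ : Measure E} [IsProbabilityMeasure ν]
    [IsProbabilityMeasure μ] (hν1 : Integrable id ν) (hμ1 : Integrable id μ)
    {τν τμ : (E →L[ℝ] E) →L[ℝ] ℝ} {α : ℝ}
    (hν : ∀ g : E → E, ContDiff ℝ 2 g → (∃ C, ∀ x, ‖fderiv ℝ g x‖ ≤ C) →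
      ∀ C2 : ℝ, (∀ x, ‖iteratedFDeriv ℝ 2 g x‖ ≤ C2) →
        |(∫ x, ⟪x, g x⟫ ∂ν) - ∫ x, τν (fderiv ℝ g x) ∂ν| ≤ α * C2)
    (hμ : ∀ g : E → E, ContDiff ℝ 1 g → (∃ C, ∀ x, ‖g x‖ ≤ C) → (∃ C, ∀ x, ‖fderiv ℝ g x‖ ≤ C) →
      ∫ x, ⟪x, g x⟫ ∂μ = ∫ x, τμ (fderiv ℝ g x) ∂μ)
    {K : ℝ} (hK0 : 0 ≤ K) (hK : ∀ A, |τν A - τμ A| ≤ K * ‖A‖)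
    {g : E → E} (hg : ContDiff ℝ 2 g) (hg0 : ∀ x, ‖g x‖ ≤ 1) (hg1 : ∀ x, ‖fderiv ℝ g x‖ ≤ 1)
    {C : ℝ} (hg2 : ∀ x, ‖iteratedFDeriv ℝ 2 g x‖ ≤ C) {a b : ℝ} (ha : 0 ≤ a) (hb : 0 ≤ b) :
    |∫ p, ⟪b • p.1 - a • p.2, g (a • p.1 + b • p.2)⟫ ∂(ν.prod μ)|
      ≤ b * (a * K + α * (a ^ 2 * C)) := by
  have hgd : Differentiable ℝ g := hg.differentiable two_ne_zero
  have hgc : Continuous g := hg.continuous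
  have hgc' : Continuous (fderiv ℝ g) := hg.continuous_fderiv two_ne_zero
  have i1 : Integrable (fun p : E × E => ⟪p.1, g (a • p.1 + b • p.2)⟫) (ν.prod μ) := by
    refine Integrable.mono' (hν1.norm.comp_fst μ) (by fun_prop) (ae_of_all _ fun p => ?_)
    exact (norm_inner_le_norm _ _).trans
      (mul_le_of_le_one_right (norm_nonneg _) (hg0 _))
  have i2 : Integrable (fun p : E × E => ⟪p.2, g (a • p.1 + b • p.2)⟫) (ν.prod μ) := by
    refine Integrable.mono' (hμ1.norm.comp_snd ν) (by fun_prop) (ae_of_all _ fun p => ?_)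
    exact (norm_inner_le_norm _ _).trans
      (mul_le_of_le_one_right (norm_nonneg _) (hg0 _))
  have iτ : ∀ τ : (E →L[ℝ] E) →L[ℝ] ℝ,
      Integrable (fun p : E × E => τ (fderiv ℝ g (a • p.1 + b • p.2))) (ν.prod μ) := by
    intro τ
    refine Integrable.of_bound (by fun_prop) ‖τ‖ (ae_of_all _ fun p => ?_)
    exact (τ.le_opNorm _).trans (mul_le_of_le_one_right (norm_nonneg _) (hg1 _))
  have e1 : |(∫ p, ⟪p.1, g (a • p.1 + b • p.2)⟫ ∂(ν.prod μ))
      - a * ∫ p, τν (fderiv ℝ g (a • p.1 + b • p.2)) ∂(ν.prod μ)| ≤ α * (a ^ 2 * C) := by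
    rw [integral_prod_symm _ i1, integral_prod_symm _ (iτ τν), ← integral_const_mul,
      ← integral_sub i1.integral_prod_right ((iτ τν).integral_prod_right.const_mul a)]
    refine abs_integral_le_of_forall_le fun y => ?_
    have hd := fderiv_comp_smul_add hgd a (b • y)
    have := hν (fun x => g (a • x + b • y)) (hg.comp (by fun_prop))
      ⟨|a| * 1, fun x => by
        rw [hd, norm_smul]
        exact mul_le_mul_of_nonneg_left (hg1 _) (abs_nonneg _)⟩ (a ^ 2 * C)
      (fun x => by
        have := norm_iteratedFDeriv_comp_smul_add_le (n := 2) hg hg2 a (b • y) x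
        rwa [abs_of_nonneg ha] at this)
    simp_rw [hd, map_smul, smul_eq_mul] at this
    rwa [integral_const_mul] at this
  have e2 : ∫ p, ⟪p.2, g (a • p.1 + b • p.2)⟫ ∂(ν.prod μ)
      = b * ∫ p, τμ (fderiv ℝ g (a • p.1 + b • p.2)) ∂(ν.prod μ) := by
    rw [integral_prod _ i2, integral_prod _ (iτ τμ), ← integral_const_mul]
    congr with x
    have hd := fderiv_comp_smul_add hgd b (a • x)
    have := hμ (fun y => g (b • y + a • x)) ((hg.of_le one_le_two).comp (by fun_prop))
      ⟨1, fun y => hg0 _⟩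
      ⟨|b| * 1, fun x => by
        rw [hd, norm_smul]
        exact mul_le_mul_of_nonneg_left (hg1 _) (abs_nonneg _)⟩
    simp_rw [hd, map_smul, smul_eq_mul] at this
    rw [integral_const_mul] at this
    simpa only [add_comm (b • _) (a • x)] using this
  have e3 : |(∫ p, τν (fderiv ℝ g (a • p.1 + b • p.2)) ∂(ν.prod μ))
      - ∫ p, τμ (fderiv ℝ g (a • p.1 + b • p.2)) ∂(ν.prod μ)| ≤ K := by
    rw [← integral_sub (iτ _) (iτ _)]
    refine abs_integral_le_of_forall_le fun p => ?_
    exact (hK _).trans (mul_le_of_le_one_right hK0 (hg1 _))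
  have e4 : ∫ p, ⟪b • p.1 - a • p.2, g (a • p.1 + b • p.2)⟫ ∂(ν.prod μ)
      = b * ((∫ p, ⟪p.1, g (a • p.1 + b • p.2)⟫ ∂(ν.prod μ))
        - a * ∫ p, τν (fderiv ℝ g (a • p.1 + b • p.2)) ∂(ν.prod μ))
      + b * a * ((∫ p, τν (fderiv ℝ g (a • p.1 + b • p.2)) ∂(ν.prod μ))
        - ∫ p, τμ (fderiv ℝ g (a • p.1 + b • p.2)) ∂(ν.prod μ)) := by
    simp_rw [inner_sub_left, inner_smul_left]
    rw [integral_sub (i1.const_mul _) (i2.const_mul _), integral_const_mul, integral_const_mul, e2]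
    simp
    ring
  rw [e4]
  refine (abs_add_le _ _).trans ?_
  rw [abs_mul, abs_mul, abs_of_nonneg hb, abs_of_nonneg (mul_nonneg hb ha)]
  nlinarith [mul_le_mul_of_nonneg_left e1 hb, mul_le_mul_of_nonneg_left e3 (mul_nonneg hb ha)]

variable [CompleteSpace E]

lemma integral_sub_integral_le_of_stein {ν μ : Measure E} [IsProbabilityMeasure ν]
    [IsProbabilityMeasure μ] (hν1 : Integrable id ν) (hμ1 : Integrable id μ)
    {τν τμ : (E →L[ℝ] E) →L[ℝ] ℝ} {α : ℝ}
    (hν : ∀ g : E → E, ContDiff ℝ 2 g → (∃ C, ∀ x, ‖fderiv ℝ g x‖ ≤ C) →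
      ∀ C2 : ℝ, (∀ x, ‖iteratedFDeriv ℝ 2 g x‖ ≤ C2) →
        |(∫ x, ⟪x, g x⟫ ∂ν) - ∫ x, τν (fderiv ℝ g x) ∂ν| ≤ α * C2)
    (hμ : ∀ g : E → E, ContDiff ℝ 1 g → (∃ C, ∀ x, ‖g x‖ ≤ C) → (∃ C, ∀ x, ‖fderiv ℝ g x‖ ≤ C) →
      ∫ x, ⟪x, g x⟫ ∂μ = ∫ x, τμ (fderiv ℝ g x) ∂μ)
    {K : ℝ} (hK0 : 0 ≤ K) (hK : ∀ A, |τν A - τμ A| ≤ K * ‖A‖)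
    {f : E → ℝ} (hf : ContDiff ℝ 3 f) (hf1 : ∀ x, ‖iteratedFDeriv ℝ 1 f x‖ ≤ 1)
    (hf2 : ∀ x, ‖iteratedFDeriv ℝ 2 f x‖ ≤ 1)
    {C : ℝ} (hf3 : ∀ x, ‖iteratedFDeriv ℝ 3 f x‖ ≤ C) :
    ∫ x, f x ∂ν - ∫ x, f x ∂μ ≤ 1 / 2 * K + α * C / 3 := by
  set g : E → E := fun x => (InnerProductSpace.toDual ℝ E).symm (fderiv ℝ f x) with hgdef
  have hfd : Differentiable ℝ f := hf.differentiable three_ne_zero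
  have hf1' : ∀ x, ‖fderiv ℝ f x‖ ≤ 1 := fun x => by
    rw [← norm_iteratedFDeriv_one]; exact hf1 x
  have hinner : ∀ x v, ⟪v, g x⟫ = fderiv ℝ f x v := fun x v => by
    rw [real_inner_comm, hgdef]; simp
  have hg : ContDiff ℝ 2 g :=
    (InnerProductSpace.toDual ℝ E).symm.contDiff.comp (hf.fderiv_right (m := 2) (by norm_num))
  have hgn : ∀ (n : ℕ) x, ‖iteratedFDeriv ℝ n g x‖ = ‖iteratedFDeriv ℝ (n + 1) f x‖ := fun n x => by
    rw [← norm_iteratedFDeriv_fderiv]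
    exact (InnerProductSpace.toDual ℝ E).symm.norm_iteratedFDeriv_comp_left (fderiv ℝ f) x n
  have hg0 : ∀ x, ‖g x‖ ≤ 1 := fun x => by simpa [hgdef] using hf1' x
  have hg1 : ∀ x, ‖fderiv ℝ g x‖ ≤ 1 := fun x => by
    rw [← norm_iteratedFDeriv_one, hgn]; exact hf2 x
  have hg2 : ∀ x, ‖iteratedFDeriv ℝ 2 g x‖ ≤ C := fun x => by rw [hgn]; exact hf3 x
  have hgc := hg.continuous
  have hfc := hf.continuous
  have hlip : LipschitzWith 1 f := lipschitzWith_of_nnnorm_fderiv_le hfd (fun x => hf1' x)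
  have hfb : ∀ x, |f x| ≤ |f 0| + ‖x‖ := fun x => by
    have := hlip.norm_sub_le x 0
    simp only [sub_zero, NNReal.coe_one, one_mul, Real.norm_eq_abs] at this
    linarith [abs_sub_abs_le_abs_sub (f x) (f 0)]
  set Z : ℝ → E × E → E := fun θ p => Real.sin θ • p.1 + Real.cos θ • p.2 with hZ
  set Z' : ℝ → E × E → E := fun θ p => Real.cos θ • p.1 - Real.sin θ • p.2 with hZ'
  have hsum : Integrable (fun p : E × E => ‖p.1‖ + ‖p.2‖) (ν.prod μ) :=
    (hν1.norm.comp_fst μ).add (hμ1.norm.comp_snd ν)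
  have hZd : ∀ p θ, HasDerivAt (fun θ => Z θ p) (Z' θ p) θ := fun p θ => by
    have := ((Real.hasDerivAt_sin θ).smul_const p.1).add ((Real.hasDerivAt_cos θ).smul_const p.2)
    refine this.congr_deriv ?_
    simp [hZ', sub_eq_add_neg]
  have hZn : ∀ θ p, ‖Z θ p‖ ≤ ‖p.1‖ + ‖p.2‖ := fun θ p => by
    refine (norm_add_le _ _).trans ?_
    rw [norm_smul, norm_smul]
    exact add_le_add (mul_le_of_le_one_left (norm_nonneg _) (Real.abs_sin_le_one _))
      (mul_le_of_le_one_left (norm_nonneg _) (Real.abs_cos_le_one _))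
  have hZn' : ∀ θ p, ‖Z' θ p‖ ≤ ‖p.1‖ + ‖p.2‖ := fun θ p => by
    refine (norm_sub_le _ _).trans ?_
    rw [norm_smul, norm_smul]
    exact add_le_add (mul_le_of_le_one_left (norm_nonneg _) (Real.abs_cos_le_one _))
      (mul_le_of_le_one_left (norm_nonneg _) (Real.abs_sin_le_one _))
  have hZc : ∀ θ, Continuous (Z θ) := fun θ => by fun_prop
  have hZc' : ∀ θ, Continuous (Z' θ) := fun θ => by fun_prop
  have hderiv : ∀ θ, HasDerivAt (fun θ => ∫ p, f (Z θ p) ∂(ν.prod μ))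
      (∫ p, ⟪Z' θ p, g (Z θ p)⟫ ∂(ν.prod μ)) θ := by
    intro θ
    refine (hasDerivAt_integral_of_dominated_loc_of_deriv_le (s := Set.univ)
      (F := fun θ p => f (Z θ p)) (F' := fun θ p => ⟪Z' θ p, g (Z θ p)⟫)
      (bound := fun p => ‖p.1‖ + ‖p.2‖) univ_mem
      (Eventually.of_forall fun θ => by fun_prop) ?_ (by fun_prop) ?_ hsum ?_).2
    · refine Integrable.mono' ((integrable_const |f 0|).add hsum) (by fun_prop)
        (ae_of_all _ fun p => ?_)
      exact (hfb _).trans (by simpa using hZn θ p)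
    · refine ae_of_all _ fun p θ _ => ?_
      exact (norm_inner_le_norm _ _).trans
        ((mul_le_of_le_one_right (norm_nonneg _) (hg0 _)).trans (hZn' _ _))
    · refine ae_of_all _ fun p θ _ => ?_
      rw [hinner]
      exact (hfd _).hasFDerivAt.comp_hasDerivAt θ (hZd p θ)
  have hB : ∀ θ, HasDerivAt (fun θ => Real.sin θ ^ 2 / 2 * K + α * C * (Real.sin θ ^ 3 / 3))
      (Real.cos θ * (Real.sin θ * K + α * (Real.sin θ ^ 2 * C))) θ := fun θ => by
    have h2 := (((Real.hasDerivAt_sin θ).pow 2).div_const 2).mul_const K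
    have h3 := (((Real.hasDerivAt_sin θ).pow 3).div_const 3).const_mul (α * C)
    refine (h2.add h3).congr_deriv ?_
    simp
    ring
  have key := image_norm_le_of_norm_deriv_right_le_deriv_boundary
    (f := fun θ => (∫ p, f (Z θ p) ∂(ν.prod μ)) - ∫ p, f (Z 0 p) ∂(ν.prod μ))
    (f' := fun θ => ∫ p, ⟪Z' θ p, g (Z θ p)⟫ ∂(ν.prod μ)) (a := 0) (b := Real.pi / 2)
    (fun θ _ => ((hderiv θ).sub_const _).continuousAt.continuousWithinAt)
    (fun θ _ => ((hderiv θ).sub_const _).hasDerivWithinAt) (by simp) hB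
    (fun θ hθ => abs_integral_interpolation_deriv_le hν1 hμ1 hν hμ hK0 hK hg hg0 hg1 hg2
      (Real.sin_nonneg_of_nonneg_of_le_pi hθ.1 (by linarith [hθ.2, Real.pi_pos]))
      (Real.cos_nonneg_of_neg_pi_div_two_le_of_le (by linarith [hθ.1, Real.pi_pos]) hθ.2.le))
    (Set.right_mem_Icc.2 (by positivity))
  have e0 : ∫ p, f (Z 0 p) ∂(ν.prod μ) = ∫ x, f x ∂μ := by
    simp only [hZ, Real.sin_zero, zero_smul, Real.cos_zero, one_smul, zero_add]
    rw [integral_fun_snd]; simp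
  have e1 : ∫ p, f (Z (Real.pi / 2) p) ∂(ν.prod μ) = ∫ x, f x ∂ν := by
    simp only [hZ, Real.sin_pi_div_two, zero_smul, Real.cos_pi_div_two, one_smul, add_zero]
    rw [integral_fun_fst]; simp
  simp only [e0, e1, Real.sin_pi_div_two, one_pow, Real.norm_eq_abs] at key
  linarith [le_abs_self (∫ x, f x ∂ν - ∫ x, f x ∂μ)]

end Interpolation

section Mollification

open ContinuousLinearMap Convolution

variable {E F : Type*} [NormedAddCommGroup E] [InnerProductSpace ℝ E] [FiniteDimensional ℝ E]
  [MeasurableSpace E] [BorelSpace E] [NormedAddCommGroup F] [NormedSpace ℝ F]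

lemma hasFDerivAt_convolution_of_bounded {ρ : E → ℝ} (hρ : Continuous ρ) (hρc : HasCompactSupport ρ)
    {f : E → F} (hf : ContDiff ℝ 1 f) {C : ℝ} (hC : ∀ x, ‖fderiv ℝ f x‖ ≤ C) (x : E) :
    HasFDerivAt (ρ ⋆[lsmul ℝ ℝ, volume] f) ((ρ ⋆[lsmul ℝ ℝ, volume] fderiv ℝ f) x) x := by
  have : ProperSpace E := FiniteDimensional.proper_real E
  have : SecondCountableTopology E := inferInstance
  have hfc := hf.continuous
  have hfc' := hf.continuous_fderiv one_ne_zero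
  have c1 : ∀ x, Continuous fun t => ρ t • f (x - t) := fun x => by fun_prop
  have c2 : Continuous fun t => ρ t • fderiv ℝ f (x - t) := by fun_prop
  refine hasFDerivAt_integral_of_dominated_of_fderiv_le (s := Set.univ)
    (F := fun x t => ρ t • f (x - t)) (F' := fun x t => ρ t • fderiv ℝ f (x - t))
    (bound := fun t => ‖ρ t‖ * C) univ_mem
    (Eventually.of_forall fun x => (c1 x).aestronglyMeasurable)
    ?_ c2.aestronglyMeasurable ?_
    ((hρ.integrable_of_hasCompactSupport hρc).norm.mul_const C) ?_
  · exact (c1 x).integrable_of_hasCompactSupport hρc.smul_right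
  · refine ae_of_all _ fun t y _ => ?_
    rw [norm_smul]
    exact mul_le_mul_of_nonneg_left (hC _) (norm_nonneg _)
  · refine ae_of_all _ fun t y _ => ?_
    have h := (hf.differentiable one_ne_zero (y - t)).hasFDerivAt.comp y
      ((hasFDerivAt_id y).sub_const t)
    exact h.const_smul (ρ t)

lemma norm_convolution_le_of_bounded {G F' : Type*} [NormedAddCommGroup G] [NormedSpace ℝ G]
    [NormedAddCommGroup F'] [NormedSpace ℝ F'] {ρ : E → G} (hρ : Continuous ρ)
    (hρc : HasCompactSupport ρ) (L : G →L[ℝ] F →L[ℝ] F') (hL : ∀ a b, ‖L a b‖ ≤ ‖a‖ * ‖b‖)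
    {f : E → F} {C : ℝ} (hC : ∀ x, ‖f x‖ ≤ C) (x : E) :
    ‖(ρ ⋆[L, volume] f) x‖ ≤ (∫ t, ‖ρ t‖) * C := by
  rw [← integral_mul_const]
  refine norm_integral_le_of_norm_le
    ((hρ.integrable_of_hasCompactSupport hρc).norm.mul_const C) (ae_of_all _ fun t => ?_)
  exact (hL _ _).trans (mul_le_mul_of_nonneg_left (hC _) (norm_nonneg _))

lemma exists_norm_fderiv_convolution_le {ρ : E → ℝ} (hρ : ContDiff ℝ 1 ρ)
    (hρc : HasCompactSupport ρ) {f : E → F} (hf : Continuous f) {C : ℝ} (hC : ∀ x, ‖f x‖ ≤ C) :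
    ∃ C', ∀ x, ‖fderiv ℝ (ρ ⋆[lsmul ℝ ℝ, volume] f) x‖ ≤ C' := by
  have hL : ∀ (a : E →L[ℝ] ℝ) (b : F),
      ‖precompL E (lsmul ℝ ℝ : ℝ →L[ℝ] F →L[ℝ] F) a b‖ ≤ ‖a‖ * ‖b‖ := fun a b =>
    opNorm_le_bound _ (by positivity) fun v => by
      rw [precompL_apply, lsmul_apply, norm_smul, mul_right_comm]
      exact mul_le_mul_of_nonneg_right (a.le_opNorm v) (norm_nonneg b)
  refine ⟨(∫ t, ‖fderiv ℝ ρ t‖) * C, fun x => ?_⟩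
  rw [(hρc.hasFDerivAt_convolution_left _ hρ hf.locallyIntegrable x).fderiv]
  exact norm_convolution_le_of_bounded (hρ.continuous_fderiv one_ne_zero) (hρc.fderiv ℝ) _
    hL hC x

lemma norm_iteratedFDeriv_convolution_le {ρ : E → ℝ} (hρ : ContDiff ℝ 1 ρ)
    (hρc : HasCompactSupport ρ) (hρ1 : ∫ t, ‖ρ t‖ = 1) {f : E → F} (hf : ContDiff ℝ 1 f) {C : ℝ}
    (hC : ∀ x, ‖fderiv ℝ f x‖ ≤ C) :
    (∀ x, ‖iteratedFDeriv ℝ 1 (ρ ⋆[lsmul ℝ ℝ, volume] f) x‖ ≤ C) ∧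
      ∃ C', ∀ x, ‖iteratedFDeriv ℝ 2 (ρ ⋆[lsmul ℝ ℝ, volume] f) x‖ ≤ C' := by
  have h : fderiv ℝ (ρ ⋆[lsmul ℝ ℝ, volume] f) = ρ ⋆[lsmul ℝ ℝ, volume] fderiv ℝ f :=
    funext fun x => (hasFDerivAt_convolution_of_bounded hρ.continuous hρc hf hC x).fderiv
  obtain ⟨C', hCderiv⟩ := exists_norm_fderiv_convolution_le hρ hρc
    (hf.continuous_fderiv one_ne_zero) hC
  refine ⟨fun x => ?_, C', fun x => ?_⟩
  · rw [norm_iteratedFDeriv_one, h]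
    refine (norm_convolution_le_of_bounded hρ.continuous hρc _
      (fun a b => (norm_smul a b).le) hC x).trans ?_
    rw [hρ1, one_mul]
  · rw [← norm_iteratedFDeriv_fderiv, norm_iteratedFDeriv_one, h]
    exact hCderiv x

/-- A `C²` function with bounded first and second derivatives is uniformly approximated by
`C³` functions with the same bounds and bounded third derivative. -/
lemma exists_contDiff_three_approx {f : E → ℝ} (hf : ContDiff ℝ 2 f)
    (hf1 : ∀ x, ‖iteratedFDeriv ℝ 1 f x‖ ≤ 1) (hf2 : ∀ x, ‖iteratedFDeriv ℝ 2 f x‖ ≤ 1)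
    {ε : ℝ} (hε : 0 < ε) :
    ∃ g : E → ℝ, ContDiff ℝ 3 g ∧ (∀ x, ‖iteratedFDeriv ℝ 1 g x‖ ≤ 1) ∧
      (∀ x, ‖iteratedFDeriv ℝ 2 g x‖ ≤ 1) ∧ (∃ C, ∀ x, ‖iteratedFDeriv ℝ 3 g x‖ ≤ C) ∧
      ∀ x, |g x - f x| ≤ ε := by
  let φ : ContDiffBump (0 : E) := ⟨ε / 2, ε, by positivity, by linarith⟩
  set ρ : E → ℝ := φ.normed volume with hρdef
  have hρ : ContDiff ℝ 3 ρ := φ.contDiff_normed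
  have hρc : HasCompactSupport ρ := φ.hasCompactSupport_normed
  have hρ1 : ∫ t, ‖ρ t‖ = 1 := by
    rw [← φ.integral_normed (μ := volume)]
    congr with t
    exact abs_of_nonneg (φ.nonneg_normed t)
  have hfc := hf.continuous
  have hf' : ContDiff ℝ 1 (fderiv ℝ f) := hf.fderiv_right (by norm_num)
  have hb1 : ∀ x, ‖fderiv ℝ f x‖ ≤ 1 := fun x => by
    rw [← norm_iteratedFDeriv_one]; exact hf1 x
  have hb2 : ∀ x, ‖fderiv ℝ (fderiv ℝ f) x‖ ≤ 1 := fun x => by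
    rw [← norm_iteratedFDeriv_one, norm_iteratedFDeriv_fderiv]; exact hf2 x
  have hg1 : fderiv ℝ (ρ ⋆[lsmul ℝ ℝ, volume] f) = ρ ⋆[lsmul ℝ ℝ, volume] fderiv ℝ f :=
    funext fun x => (hasFDerivAt_convolution_of_bounded hρ.continuous hρc
      (hf.of_le one_le_two) hb1 x).fderiv
  obtain ⟨h2, C, h3⟩ := norm_iteratedFDeriv_convolution_le (hρ.of_le (by norm_num)) hρc hρ1 hf' hb2
  refine ⟨ρ ⋆[lsmul ℝ ℝ, volume] f, hρc.contDiff_convolution_left _ hρ hfc.locallyIntegrable,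
    fun x => ?_, fun x => ?_, ⟨C, fun x => ?_⟩, fun x => ?_⟩
  · exact (norm_iteratedFDeriv_convolution_le (hρ.of_le (by norm_num)) hρc hρ1
      (hf.of_le one_le_two) hb1).1 x
  · rw [← norm_iteratedFDeriv_fderiv, hg1]
    exact h2 x
  · rw [← norm_iteratedFDeriv_fderiv, hg1]
    exact h3 x
  · have hlip : LipschitzWith 1 f :=
      lipschitzWith_of_nnnorm_fderiv_le (hf.differentiable two_ne_zero) (fun x => hb1 x)
    refine φ.dist_normed_convolution_le hfc.aestronglyMeasurable fun y hy => ?_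
    refine (hlip.dist_le_mul y x).trans ?_
    rw [NNReal.coe_one, one_mul]
    exact (Metric.mem_ball.1 hy).le

end Mollification

/-- The canonical orthonormal basis of `ℓ²(ℕ)` as a Hilbert basis. -/
def xbBasis : HilbertBasis ℕ ℝ l2 := HilbertBasis.ofRepr (LinearIsometryEquiv.refl ℝ l2)

lemma xbBasis_apply (n : ℕ) : xbBasis n = xb n := by
  rw [← xbBasis.repr_symm_single n]
  change (lp.single 2 n (1 : ℝ) : l2) = xb n
  unfold xb
  congr!

lemma orthonormal_xb : Orthonormal ℝ xb := by
  have h := xbBasis.orthonormal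
  rwa [show (xbBasis : ℕ → l2) = xb from funext xbBasis_apply] at h

lemma inner_xb (n : ℕ) (x : l2) : ⟪xb n, x⟫ = (x : ∀ _ : ℕ, ℝ) n := by
  rw [← xbBasis_apply, ← xbBasis.repr_apply_apply]
  rfl

lemma hasSum_inner_xb_smul (x : l2) : HasSum (fun n => ⟪xb n, x⟫ • xb n) x := by
  simpa only [xbBasis.repr_apply_apply, xbBasis_apply] using xbBasis.hasSum_repr x

lemma hasSum_inner_xb_sq (x : l2) : HasSum (fun n => ⟪xb n, x⟫ ^ 2) (‖x‖ ^ 2) := by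
  have h := xbBasis.hasSum_inner_mul_inner x x
  rw [real_inner_self_eq_norm_sq] at h
  refine h.congr_fun fun n => ?_
  rw [xbBasis_apply, real_inner_comm, sq]

instance : SecondCountableTopology l2 := by
  have hsep : TopologicalSpace.IsSeparable (Set.univ : Set l2) := by
    have h := (Set.countable_range xbBasis).isSeparable.span (R := ℝ)
    have h2 := h.closure
    rw [← Submodule.topologicalClosure_coe, xbBasis.dense_span] at h2
    exact h2
  have := TopologicalSpace.isSeparable_univ_iff.1 hsep
  exact UniformSpace.secondCountable_of_separable l2

/-- The isometric embedding of `ℝᴺ` into `ℓ²(ℕ)` as the span of the first `N` basis vectors. -/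
def l2emb (N : ℕ) : EuclideanSpace ℝ (Fin N) →ₗᵢ[ℝ] l2 :=
  ((EuclideanSpace.basisFun (Fin N) ℝ).toBasis.constr ℝ fun i : Fin N => xb i).isometryOfOrthonormal
    (v := (EuclideanSpace.basisFun (Fin N) ℝ).toBasis)
    (by simp [(EuclideanSpace.basisFun (Fin N) ℝ).orthonormal])
    (by
      have : (((EuclideanSpace.basisFun (Fin N) ℝ).toBasis.constr ℝ fun i : Fin N => xb i) ∘
          (EuclideanSpace.basisFun (Fin N) ℝ).toBasis) = fun i : Fin N => xb i :=
        funext fun i => Module.Basis.constr_basis _ _ _ _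
      rw [this]
      exact orthonormal_xb.comp _ Fin.val_injective)

/-- The orthogonal projection of `ℓ²(ℕ)` onto the first `N` coordinates. -/
def l2proj (N : ℕ) : l2 →L[ℝ] EuclideanSpace ℝ (Fin N) :=
  (l2emb N).toContinuousLinearMap.adjoint

lemma l2emb_single {N : ℕ} (i : Fin N) : l2emb N (EuclideanSpace.single i 1) = xb i := by
  have h := Module.Basis.constr_basis (EuclideanSpace.basisFun (Fin N) ℝ).toBasis ℝ
    (fun i : Fin N => xb i) i
  rwa [OrthonormalBasis.coe_toBasis, EuclideanSpace.basisFun_apply] at h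

lemma l2emb_apply {N : ℕ} (v : EuclideanSpace ℝ (Fin N)) : l2emb N v = ∑ i, v i • xb i := by
  conv_lhs => rw [← (EuclideanSpace.basisFun (Fin N) ℝ).sum_repr v]
  simp [l2emb_single]

lemma inner_l2emb {N : ℕ} (v : EuclideanSpace ℝ (Fin N)) (x : l2) :
    ⟪l2emb N v, x⟫ = ⟪v, l2proj N x⟫ :=
  ((l2emb N).toContinuousLinearMap.adjoint_inner_right v x).symm

lemma l2proj_apply {N : ℕ} (x : l2) (i : Fin N) : l2proj N x i = ⟪xb i, x⟫ := by
  rw [← l2emb_single, inner_l2emb, EuclideanSpace.inner_single_left]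
  simp

lemma l2proj_l2emb {N : ℕ} (v : EuclideanSpace ℝ (Fin N)) : l2proj N (l2emb N v) = v :=
  ext_inner_left ℝ fun w => by rw [← inner_l2emb, LinearIsometry.inner_map_map]

lemma norm_l2proj_le (N : ℕ) : ‖l2proj N‖ ≤ 1 := by
  rw [l2proj, LinearIsometryEquiv.norm_map]
  exact (l2emb N).norm_toContinuousLinearMap_le

lemma norm_l2proj_apply_le {N : ℕ} (x : l2) : ‖l2proj N x‖ ≤ ‖x‖ :=
  ((l2proj N).le_opNorm x).trans (mul_le_of_le_one_left (norm_nonneg _) (norm_l2proj_le N))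

lemma l2proj_xb_of_lt {N n : ℕ} (hn : n < N) :
    l2proj N (xb n) = EuclideanSpace.single ⟨n, hn⟩ 1 := by
  rw [← l2proj_l2emb (EuclideanSpace.single (⟨n, hn⟩ : Fin N) (1 : ℝ)), l2emb_single]

lemma l2proj_xb_of_le {N n : ℕ} (hn : N ≤ n) : l2proj N (xb n) = 0 := by
  ext i
  rw [l2proj_apply, orthonormal_xb.inner_eq_zero (by have := i.2; omega)]
  rfl

lemma l2emb_l2proj {N : ℕ} (x : l2) :
    l2emb N (l2proj N x) = ∑ i ∈ Finset.range N, ⟪xb i, x⟫ • xb i := by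
  rw [l2emb_apply, ← Fin.sum_univ_eq_sum_range (fun i => ⟪xb i, x⟫ • xb i)]
  simp only [l2proj_apply]

lemma tendsto_l2emb_l2proj (x : l2) :
    Tendsto (fun N => l2emb N (l2proj N x)) atTop (nhds x) := by
  simp only [l2emb_l2proj]
  exact (hasSum_inner_xb_smul x).tendsto_sum_nat

section Gram

variable {V : Type*} [NormedAddCommGroup V] [InnerProductSpace ℝ V]

/-- The linear functional `A ↦ trace (G ∘ A)` on operators of `ℝᴺ`, where `G` is the Gram matrix
of the first `N` vectors of the family `h`. -/
def gramTrace (h : ℕ → V) (N : ℕ) :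
    (EuclideanSpace ℝ (Fin N) →L[ℝ] EuclideanSpace ℝ (Fin N)) →L[ℝ] ℝ :=
  ∑ n : Fin N, ∑ k : Fin N, ⟪h n, h k⟫ • (EuclideanSpace.proj k).comp
    (ContinuousLinearMap.apply ℝ (EuclideanSpace ℝ (Fin N)) (EuclideanSpace.single n (1 : ℝ)))

lemma gramTrace_apply (h : ℕ → V) (N : ℕ)
    (A : EuclideanSpace ℝ (Fin N) →L[ℝ] EuclideanSpace ℝ (Fin N)) :
    gramTrace h N A = ∑ n : Fin N, ∑ k : Fin N,
      ⟪h n, h k⟫ * A (EuclideanSpace.single n (1 : ℝ)) k := by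
  simp [gramTrace]

/-- The quadratic form of the Gram matrix of the family `h`. -/
def gramForm (h : ℕ → V) (v : l2) : ℝ :=
  ∑' n, ∑' k, ⟪h n, h k⟫ * (v : ∀ _ : ℕ, ℝ) n * (v : ∀ _ : ℕ, ℝ) k

lemma gramForm_smul (h : ℕ → V) (t : ℝ) (v : l2) : gramForm h (t • v) = t ^ 2 * gramForm h v := by
  simp only [gramForm, ← tsum_mul_left]
  refine tsum_congr fun n => tsum_congr fun k => ?_
  simp only [lp.coeFn_smul, Pi.smul_apply, smul_eq_mul]
  ring

/-- The linear combination map of the first `N` vectors of the family `h`. -/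
def gramLinear (h : ℕ → V) (N : ℕ) : EuclideanSpace ℝ (Fin N) →ₗ[ℝ] V :=
  Fintype.linearCombination ℝ (fun i : Fin N => h i) ∘ₗ
    (WithLp.linearEquiv 2 ℝ (Fin N → ℝ)).toLinearMap

lemma gramLinear_apply (h : ℕ → V) (N : ℕ) (v : EuclideanSpace ℝ (Fin N)) :
    gramLinear h N v = ∑ i, v i • h i := by
  simp [gramLinear, Fintype.linearCombination_apply]

lemma gramLinear_single (h : ℕ → V) {N : ℕ} (i : Fin N) :
    gramLinear h N (EuclideanSpace.single i 1) = h i := by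
  rw [gramLinear_apply, Finset.sum_eq_single i]
  · simp
  · intro j _ hj
    simp [hj]
  · simp

lemma l2emb_coe {N : ℕ} (v : EuclideanSpace ℝ (Fin N)) (n : ℕ) :
    (l2emb N v : ∀ _ : ℕ, ℝ) n = if hn : n < N then v ⟨n, hn⟩ else 0 := by
  rw [← inner_xb, real_inner_comm, inner_l2emb]
  split_ifs with hn
  · rw [l2proj_xb_of_lt hn, EuclideanSpace.inner_single_right]
    simp
  · rw [l2proj_xb_of_le (not_lt.1 hn), inner_zero_right]

lemma tsum_mul_l2emb {N : ℕ} (c : ℕ → ℝ) (v : EuclideanSpace ℝ (Fin N)) :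
    ∑' n, c n * (l2emb N v : ∀ _ : ℕ, ℝ) n = ∑ i : Fin N, c i * v i := by
  rw [tsum_eq_sum (s := Finset.range N) fun n hn => by
    rw [l2emb_coe, dif_neg (by simpa using hn), mul_zero],
    ← Fin.sum_univ_eq_sum_range (fun n => c n * (l2emb N v : ∀ _ : ℕ, ℝ) n)]
  refine Finset.sum_congr rfl fun i _ => ?_
  rw [l2emb_coe, dif_pos i.2]

lemma gramForm_l2emb (h : ℕ → V) {N : ℕ} (v : EuclideanSpace ℝ (Fin N)) :
    gramForm h (l2emb N v) = ‖gramLinear h N v‖ ^ 2 := by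
  rw [← real_inner_self_eq_norm_sq, gramLinear_apply]
  simp only [gramForm, tsum_mul_l2emb, sum_inner, inner_sum]
  have : ∀ n, ∑ k : Fin N, ⟪h n, h k⟫ * (l2emb N v : ∀ _ : ℕ, ℝ) n * v k
      = (∑ k : Fin N, ⟪h n, h k⟫ * v k) * (l2emb N v : ∀ _ : ℕ, ℝ) n := fun n => by
    rw [Finset.sum_mul]
    exact Finset.sum_congr rfl fun k _ => by ring
  simp only [this]
  rw [tsum_mul_l2emb]
  simp only [Finset.sum_mul]
  refine Finset.sum_congr rfl fun n _ => Finset.sum_congr rfl fun k _ => ?_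
  rw [real_inner_smul_left, real_inner_smul_right, real_inner_comm]
  ring

lemma gramForm_xb (h : ℕ → V) (n : ℕ) : gramForm h (xb n) = ‖h n‖ ^ 2 := by
  have h1 := l2emb_single (Fin.last n)
  rw [Fin.val_last] at h1
  rw [← h1, gramForm_l2emb, gramLinear_single, Fin.val_last]

/-- The probability measure `μ` is centered Gaussian with covariance the Gram matrix of `h`. -/
def HasGramCharFun (μ : Measure l2) (h : ℕ → V) : Prop :=
  ∀ v, charFun μ v = Complex.exp (-((gramForm h v / 2 : ℝ) : ℂ))

variable {μ : Measure l2} {h : ℕ → V}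

lemma HasGramCharFun.charFun_map (hμ : HasGramCharFun μ h) (N : ℕ)
    (v : EuclideanSpace ℝ (Fin N)) :
    charFun (μ.map (l2proj N)) v = Complex.exp (-((‖gramLinear h N v‖ ^ 2 / 2 : ℝ) : ℂ)) := by
  rw [← gramForm_l2emb, ← hμ, charFun_apply, charFun_apply,
    integral_map (by fun_prop) (by fun_prop)]
  congr with x
  rw [real_inner_comm, ← inner_l2emb, real_inner_comm]

variable [IsProbabilityMeasure μ]

lemma HasGramCharFun.gramForm_nonneg (hμ : HasGramCharFun μ h) (v : l2) : 0 ≤ gramForm h v := by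
  have h1 := norm_charFun_le_one (μ := μ) v
  rw [hμ v, ← Complex.ofReal_neg, Complex.norm_exp_ofReal, Real.exp_le_one_iff] at h1
  linarith

lemma HasGramCharFun.map_inner (hμ : HasGramCharFun μ h) (v : l2) :
    μ.map (fun x => ⟪v, x⟫) = gaussianReal 0 (gramForm h v).toNNReal := by
  have hm : Measurable fun x : l2 => ⟪v, x⟫ := by fun_prop
  have := Measure.isProbabilityMeasure_map (μ := μ) hm.aemeasurable
  refine Measure.ext_of_charFun (funext fun t => ?_)
  have h1 : charFun (μ.map fun x => ⟪v, x⟫) t = charFun μ (t • v) := by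
    rw [charFun_apply, charFun_apply, integral_map hm.aemeasurable (by fun_prop)]
    congr with x
    rw [real_inner_smul_right, real_inner_comm v x]
    simp [mul_comm]
  rw [h1, hμ, gramForm_smul, charFun_gaussianReal]
  congr 1
  rw [Complex.ofReal_zero, mul_zero, zero_mul, zero_sub,
    show ((gramForm h v).toNNReal : ℂ) = ((gramForm h v : ℝ) : ℂ) by
      rw [← Real.coe_toNNReal _ (hμ.gramForm_nonneg v)]; simp]
  push_cast
  ring

lemma HasGramCharFun.isGaussian (hμ : HasGramCharFun μ h) : IsGaussian μ := by
  refine isGaussian_of_map_eq_gaussianReal fun L =>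
    ⟨0, (gramForm h ((InnerProductSpace.toDual ℝ l2).symm L)).toNNReal, ?_⟩
  rw [← hμ.map_inner]
  congr with x
  rw [InnerProductSpace.toDual_symm_apply]

lemma HasGramCharFun.integral_inner_sq (hμ : HasGramCharFun μ h) (n : ℕ) :
    ∫ x, ⟪xb n, x⟫ ^ 2 ∂μ = ‖h n‖ ^ 2 := by
  have hm : Measurable fun x : l2 => ⟪xb n, x⟫ := by fun_prop
  have h1 : ∫ x, ⟪xb n, x⟫ ^ 2 ∂μ = ∫ y, y ^ 2 ∂(μ.map fun x => ⟪xb n, x⟫) := by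
    rw [integral_map hm.aemeasurable (by fun_prop)]
  have h2 := variance_fun_id_gaussianReal (μ := 0) (v := (gramForm h (xb n)).toNNReal)
  rw [variance_of_integral_eq_zero (by fun_prop) (by simp)] at h2
  rw [h1, hμ.map_inner, h2, Real.coe_toNNReal _ (hμ.gramForm_nonneg _), gramForm_xb]

lemma HasGramCharFun.summable (hμ : HasGramCharFun μ h) : Summable fun n => ‖h n‖ ^ 2 := by
  have := hμ.isGaussian
  have h2 : MemLp id 2 μ := IsGaussian.memLp_two_id
  have h3 : ∀ n, Integrable (fun x : l2 => ⟪xb n, x⟫ ^ 2) μ := fun n =>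
    (h2.const_inner (𝕜 := ℝ) (xb n)).integrable_sq
  refine summable_of_sum_le (c := ∫ x, ‖x‖ ^ 2 ∂μ) (fun n => sq_nonneg _) fun s => ?_
  simp only [← hμ.integral_inner_sq]
  rw [← integral_finsetSum _ fun n _ => h3 n]
  exact integral_mono (integrable_finsetSum _ fun n _ => h3 n)
    (h2.integrable_norm_pow two_ne_zero)
    fun x => sum_le_hasSum s (fun i _ => sq_nonneg _) (hasSum_inner_xb_sq x)

lemma HasGramCharFun.integral_inner_eq (hμ : HasGramCharFun μ h) (N : ℕ)
    {g : EuclideanSpace ℝ (Fin N) → EuclideanSpace ℝ (Fin N)} (hg : ContDiff ℝ 1 g)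
    {C C' : ℝ} (hC : ∀ x, ‖g x‖ ≤ C) (hC' : ∀ x, ‖fderiv ℝ g x‖ ≤ C') :
    ∫ x, ⟪x, g x⟫ ∂(μ.map (l2proj N)) = ∫ x, gramTrace h N (fderiv ℝ g x) ∂(μ.map (l2proj N)) := by
  have := hμ.isGaussian
  have hid : Integrable id (μ.map (l2proj N)) := IsGaussian.integrable_id
  have hint : ∀ A : (EuclideanSpace ℝ (Fin N) →L[ℝ] EuclideanSpace ℝ (Fin N)) →L[ℝ] ℝ,
      Integrable (fun x => A (fderiv ℝ g x)) (μ.map (l2proj N)) := fun A =>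
    A.integrable_comp <| (integrable_const C').mono'
      (hg.continuous_fderiv one_ne_zero).aestronglyMeasurable (ae_of_all _ hC')
  have hgi : ∀ i y, |g y i| ≤ C := fun i y =>
    (PiLp.norm_apply_le (g y) i).trans (hC y)
  have hgd : ∀ i y, HasFDerivAt (fun z => g z i)
      ((EuclideanSpace.proj i).comp (fderiv ℝ g y)) y := fun i y =>
    (EuclideanSpace.proj (𝕜 := ℝ) i).hasFDerivAt.comp y
      (hg.differentiable one_ne_zero y).hasFDerivAt
  have hfd : ∀ i y, fderiv ℝ (fun z => g z i) y = (EuclideanSpace.proj i).comp (fderiv ℝ g y) :=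
    fun i y => (hgd i y).fderiv
  have key : ∀ i : Fin N, ∫ y, y i * g y i ∂(μ.map (l2proj N))
      = ∑ k : Fin N, ⟪h i, h k⟫ *
        ∫ y, fderiv ℝ g y (EuclideanSpace.single k (1 : ℝ)) i ∂(μ.map (l2proj N)) := fun i => by
    have h1 := integral_inner_mul_gaussian (gramLinear h N) (hμ.charFun_map N) hid
      (v := EuclideanSpace.single i 1)
      (w := ∑ k : Fin N, ⟪h i, h k⟫ • EuclideanSpace.single k (1 : ℝ))
      (u := fun y => g y i) (C := C) (C' := C') (fun z => ?_)
      ((EuclideanSpace.proj (𝕜 := ℝ) i).contDiff.comp hg) (hgi i) (fun y => ?_)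
    · simp only [hfd, EuclideanSpace.inner_single_left, map_one, one_mul] at h1
      rw [h1]
      simp only [map_sum, map_smul, smul_eq_mul]
      rw [integral_finsetSum]
      · refine Finset.sum_congr rfl fun k _ => ?_
        rw [integral_const_mul]
        rfl
      · exact fun k _ => (hint ((EuclideanSpace.proj i).comp (ContinuousLinearMap.apply ℝ _
          (EuclideanSpace.single k (1 : ℝ))))).const_mul _
    · rw [gramLinear_single, gramLinear_apply, sum_inner, inner_sum]
      refine Finset.sum_congr rfl fun k _ => ?_
      rw [real_inner_smul_left, real_inner_smul_right, EuclideanSpace.inner_single_left, map_one,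
        one_mul, mul_comm]
    · rw [hfd]
      refine ContinuousLinearMap.opNorm_le_bound _ ((norm_nonneg _).trans (hC' y)) fun z => ?_
      exact (PiLp.norm_apply_le (fderiv ℝ g y z) i).trans
        ((fderiv ℝ g y).le_of_opNorm_le (hC' y) z)
  simp only [PiLp.inner_apply, gramTrace_apply]
  rw [integral_finsetSum, integral_finsetSum]
  · have h2 : ∀ i, ∫ x, ⟪x i, g x i⟫ ∂(μ.map (l2proj N)) =
        ∫ x, x i * g x i ∂(μ.map (l2proj N)) := fun i => by
      simp [mul_comm]
    simp only [h2, key]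
    rw [Finset.sum_comm]
    refine Finset.sum_congr rfl fun n _ => ?_
    rw [integral_finsetSum]
    · refine Finset.sum_congr rfl fun k _ => ?_
      rw [integral_const_mul, real_inner_comm]
    · exact fun k _ => (hint ((EuclideanSpace.proj k).comp (ContinuousLinearMap.apply ℝ _
          (EuclideanSpace.single n (1 : ℝ))))).const_mul _
  · exact fun n _ => integrable_finsetSum _ fun k _ =>
      (hint ((EuclideanSpace.proj k).comp (ContinuousLinearMap.apply ℝ _
          (EuclideanSpace.single n (1 : ℝ))))).const_mul _
  · intro i _
    have h3 : Integrable (fun x => x i) (μ.map (l2proj N)) :=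
      (EuclideanSpace.proj (𝕜 := ℝ) i).integrable_comp hid
    have h4 := h3.bdd_mul (f := fun x => g x i) (c := C)
      ((EuclideanSpace.proj (𝕜 := ℝ) i).continuous.comp hg.continuous).aestronglyMeasurable
      (ae_of_all _ (hgi i))
    exact h4

end Gram

section Stein

variable {X : Type*} [NormedAddCommGroup X] [InnerProductSpace ℝ X] {ν : Measure l2}
  {H : ℕ → X} {α : ℝ}

/-- The finite-dimensional marginals of a measure satisfying the Stein hypothesis satisfy the
corresponding finite-dimensional hypothesis. -/
lemma SteinHyp.map_l2proj (hν : SteinHyp ν H α) (N : ℕ)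
    {g : EuclideanSpace ℝ (Fin N) → EuclideanSpace ℝ (Fin N)} (hg : ContDiff ℝ 2 g)
    (hb : ∃ C, ∀ x, ‖fderiv ℝ g x‖ ≤ C) (C2 : ℝ) (hC2 : ∀ x, ‖iteratedFDeriv ℝ 2 g x‖ ≤ C2) :
    |(∫ x, ⟪x, g x⟫ ∂(ν.map (l2proj N))) -
      ∫ x, gramTrace H N (fderiv ℝ g x) ∂(ν.map (l2proj N))| ≤ α * C2 := by
  have hgp : ContDiff ℝ 2 (g ∘ l2proj N) := hg.comp (l2proj N).contDiff
  have hG : ContDiff ℝ 2 (l2emb N ∘ (g ∘ l2proj N)) := (l2emb N).contDiff.comp hgp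
  have hd : ∀ x, fderiv ℝ (l2emb N ∘ (g ∘ l2proj N)) x
      = (l2emb N).toContinuousLinearMap ∘L (fderiv ℝ g (l2proj N x) ∘L l2proj N) := fun x =>
    ((l2emb N).toContinuousLinearMap.hasFDerivAt.comp x
      ((hg.differentiable two_ne_zero _).hasFDerivAt.comp x (l2proj N).hasFDerivAt)).fderiv
  have h := hν _ hG ?_ C2 fun x => ?_
  · convert h using 2
    congr 1
    · rw [integral_map (by fun_prop) (continuous_id.inner hg.continuous).aestronglyMeasurable]
      congr with x
      rw [Function.comp_apply, Function.comp_apply, real_inner_comm, real_inner_comm (l2emb N _),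
        inner_l2emb]
    · have hc : Continuous fun x => gramTrace H N (fderiv ℝ g x) :=
        (gramTrace H N).continuous.comp (hg.continuous_fderiv two_ne_zero)
      rw [integral_map (by fun_prop) hc.aestronglyMeasurable]
      congr with x
      rw [gramTrace_apply]
      simp only [hd, ContinuousLinearMap.comp_apply, LinearIsometry.coe_toContinuousLinearMap,
        tsum_mul_l2emb]
      rw [tsum_eq_sum (s := Finset.range N) fun n hn => ?_]
      · rw [← Fin.sum_univ_eq_sum_range (fun n => ∑ k : Fin N, ⟪H n, H k⟫ *
          (fderiv ℝ g (l2proj N x)) (l2proj N (xb n)) k)]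
        simp only [l2proj_xb_of_lt (Fin.is_lt _), Fin.eta]
      · simp [l2proj_xb_of_le (by simpa using hn : N ≤ n)]
  · obtain ⟨C, hC⟩ := hb
    refine ⟨C, fun x => ?_⟩
    rw [hd, LinearIsometry.norm_toContinuousLinearMap_comp]
    refine (ContinuousLinearMap.opNorm_comp_le _ _).trans ?_
    exact (mul_le_of_le_one_right (norm_nonneg _) (norm_l2proj_le N)).trans (hC _)
  · rw [(l2emb N).norm_iteratedFDeriv_comp_left hgp.contDiffAt le_rfl]
    refine (norm_iteratedFDeriv_comp_right_le hg (l2proj N) x).trans ?_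
    exact (mul_le_of_le_one_right (norm_nonneg _)
      (pow_le_one₀ (norm_nonneg _) (norm_l2proj_le N))).trans (hC2 _)

lemma hasDerivAt_div_one_add_sq (ε t : ℝ) : HasDerivAt (fun t => t / (1 + ε ^ 2 * t ^ 2))
    ((1 - ε ^ 2 * t ^ 2) / (1 + ε ^ 2 * t ^ 2) ^ 2) t := by
  have h0 : 1 + ε ^ 2 * t ^ 2 ≠ 0 := by positivity
  have h1 : HasDerivAt (fun t => 1 + ε ^ 2 * t ^ 2) (ε ^ 2 * (2 * t)) t := by
    simpa using ((hasDerivAt_pow 2 t).const_mul (ε ^ 2)).const_add 1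
  exact ((hasDerivAt_id t).div h1 h0).congr_deriv (by simp only [id]; ring)

lemma contDiff_div_one_add_sq (ε : ℝ) : ContDiff ℝ 2 fun t : ℝ => t / (1 + ε ^ 2 * t ^ 2) :=
  contDiff_id.div (by fun_prop) fun t => by positivity

lemma hasDerivAt_deriv_div_one_add_sq (ε t : ℝ) :
    HasDerivAt (fun t => (1 - ε ^ 2 * t ^ 2) / (1 + ε ^ 2 * t ^ 2) ^ 2)
    (2 * ε ^ 2 * t * (ε ^ 2 * t ^ 2 - 3) / (1 + ε ^ 2 * t ^ 2) ^ 3) t := by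
  have h0 : 1 + ε ^ 2 * t ^ 2 ≠ 0 := by positivity
  have h1 : HasDerivAt (fun t => 1 + ε ^ 2 * t ^ 2) (ε ^ 2 * (2 * t)) t := by
    simpa using ((hasDerivAt_pow 2 t).const_mul (ε ^ 2)).const_add 1
  have h2 : HasDerivAt (fun t => 1 - ε ^ 2 * t ^ 2) (-(ε ^ 2 * (2 * t))) t := by
    simpa using ((hasDerivAt_pow 2 t).const_mul (ε ^ 2)).const_sub 1
  refine (h2.div (h1.pow 2) (pow_ne_zero 2 h0)).congr_deriv ?_
  simp only [Pi.pow_apply]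
  field_simp
  ring

lemma norm_iteratedFDeriv_two_div_one_add_sq_le {ε : ℝ} (hε : 0 < ε) (t : ℝ) :
    ‖iteratedFDeriv ℝ 2 (fun t : ℝ => t / (1 + ε ^ 2 * t ^ 2)) t‖ ≤ 6 * ε := by
  rw [norm_iteratedFDeriv_eq_norm_iteratedDeriv, iteratedDeriv_succ, iteratedDeriv_one,
    funext fun t => (hasDerivAt_div_one_add_sq ε t).deriv,
    (hasDerivAt_deriv_div_one_add_sq ε t).deriv, Real.norm_eq_abs, abs_div,
    abs_of_pos (by positivity : 0 < (1 + ε ^ 2 * t ^ 2) ^ 3), div_le_iff₀ (by positivity), abs_mul]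
  have h1 : |2 * ε ^ 2 * t| ≤ 2 * ε * (1 + ε ^ 2 * t ^ 2) := by
    rw [abs_le]
    constructor <;> nlinarith [sq_nonneg (ε * t - 1), sq_nonneg (ε * t + 1)]
  have h2 : |ε ^ 2 * t ^ 2 - 3| ≤ 3 * (1 + ε ^ 2 * t ^ 2) := by
    rw [abs_le]
    constructor <;> nlinarith [sq_nonneg (ε * t)]
  have h3 := mul_le_mul h1 h2 (abs_nonneg _) (by positivity)
  refine h3.trans ?_
  have h4 : 1 ≤ 1 + ε ^ 2 * t ^ 2 := by nlinarith [sq_nonneg (ε * t)]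
  have h5 : (1 + ε ^ 2 * t ^ 2) ^ 2 ≤ (1 + ε ^ 2 * t ^ 2) ^ 3 := pow_le_pow_right₀ h4 (by norm_num)
  nlinarith

lemma abs_deriv_div_one_add_sq_le (ε t : ℝ) :
    |(1 - ε ^ 2 * t ^ 2) / (1 + ε ^ 2 * t ^ 2) ^ 2| ≤ 1 := by
  have h : 0 ≤ ε ^ 2 * t ^ 2 := by positivity
  rw [abs_div, abs_of_pos (by positivity : 0 < (1 + ε ^ 2 * t ^ 2) ^ 2), div_le_one (by positivity),
    abs_le]
  constructor <;> nlinarith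

lemma SteinHyp.integral_div_one_add_sq_le [IsProbabilityMeasure ν] (hν : SteinHyp ν H α) (n : ℕ)
    {ε : ℝ} (hε : 0 < ε) :
    ∫ x, ⟪xb n, x⟫ ^ 2 / (1 + ε ^ 2 * ⟪xb n, x⟫ ^ 2) ∂ν ≤ ‖H n‖ ^ 2 + α * (6 * ε) := by
  set u : ℝ → ℝ := fun t => t / (1 + ε ^ 2 * t ^ 2) with hu
  have huc : ContDiff ℝ 2 u := contDiff_div_one_add_sq ε
  set i : Fin (n + 1) := Fin.last n
  set e : EuclideanSpace ℝ (Fin (n + 1)) := EuclideanSpace.single i 1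
  have he : ‖e‖ = 1 := by simp [e]
  set p : EuclideanSpace ℝ (Fin (n + 1)) →L[ℝ] ℝ := EuclideanSpace.proj i
  have hp : ‖p‖ ≤ 1 := p.opNorm_le_bound zero_le_one fun y => by
    rw [one_mul]
    exact PiLp.norm_apply_le y i
  have hup : ContDiff ℝ 2 (u ∘ p) := huc.comp p.contDiff
  set g : EuclideanSpace ℝ (Fin (n + 1)) → EuclideanSpace ℝ (Fin (n + 1)) :=
    LinearIsometry.toSpanSingleton ℝ _ he ∘ (u ∘ p) with hg
  have hgc : ContDiff ℝ 2 g := (LinearIsometry.toSpanSingleton ℝ _ he).contDiff.comp hup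
  have hg' : ∀ y, g y = u (y i) • e := fun y => rfl
  have hgd : ∀ y z, fderiv ℝ g y z
      = ((1 - ε ^ 2 * y i ^ 2) / (1 + ε ^ 2 * y i ^ 2) ^ 2 * z i) • e := fun y z => by
    have h1 := ((hasDerivAt_div_one_add_sq ε (p y)).comp_hasFDerivAt y p.hasFDerivAt).smul_const e
    rw [show g = fun y => ((fun t => t / (1 + ε ^ 2 * t ^ 2)) ∘ p) y • e from rfl, h1.fderiv]
    rfl
  have h := hν.map_l2proj (n + 1) hgc ⟨1, fun y => ?_⟩ (6 * ε) fun y => ?_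
  · have h1 : ∫ x, ⟪x, g x⟫ ∂(ν.map (l2proj (n + 1)))
        = ∫ x, ⟪xb n, x⟫ ^ 2 / (1 + ε ^ 2 * ⟪xb n, x⟫ ^ 2) ∂ν := by
      rw [integral_map (by fun_prop) (continuous_id.inner hgc.continuous).aestronglyMeasurable]
      congr with x
      rw [hg', real_inner_smul_right, EuclideanSpace.inner_single_right, l2proj_apply]
      simp only [hu, i, Fin.val_last, conj_trivial]
      ring
    have h2 : |∫ x, gramTrace H (n + 1) (fderiv ℝ g x) ∂(ν.map (l2proj (n + 1)))|
        ≤ ‖H n‖ ^ 2 := by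
      have := Measure.isProbabilityMeasure_map (μ := ν) (l2proj (n + 1)).measurable.aemeasurable
      refine abs_integral_le_of_forall_le fun y => ?_
      have h3 : gramTrace H (n + 1) (fderiv ℝ g y)
          = ‖H n‖ ^ 2 * ((1 - ε ^ 2 * y i ^ 2) / (1 + ε ^ 2 * y i ^ 2) ^ 2) := by
        have h4 : ∀ j k : Fin (n + 1), fderiv ℝ g y (EuclideanSpace.single j (1 : ℝ)) k
            = (1 - ε ^ 2 * y i ^ 2) / (1 + ε ^ 2 * y i ^ 2) ^ 2 * (if i = j then 1 else 0)
              * (if k = i then 1 else 0) := fun j k => by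
          rw [hgd, PiLp.smul_apply, PiLp.single_apply, PiLp.single_apply, smul_eq_mul]
        simp [gramTrace_apply, h4, i]
      rw [h3, abs_mul, abs_of_nonneg (sq_nonneg _)]
      exact mul_le_of_le_one_right (sq_nonneg _) (abs_deriv_div_one_add_sq_le _ _)
    rw [h1] at h
    linarith [(abs_le.1 h).2, (abs_le.1 h2).2]
  · refine ContinuousLinearMap.opNorm_le_bound _ zero_le_one fun z => ?_
    rw [hgd, norm_smul, he, mul_one, norm_mul]
    exact mul_le_mul (abs_deriv_div_one_add_sq_le _ _) (PiLp.norm_apply_le z i) (norm_nonneg _)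
      zero_le_one
  · rw [hg, LinearIsometry.norm_iteratedFDeriv_comp_left _ hup.contDiffAt le_rfl]
    refine (norm_iteratedFDeriv_comp_right_le huc p y).trans ?_
    exact (mul_le_of_le_one_right (norm_nonneg _) (pow_le_one₀ (norm_nonneg _) hp)).trans
      (norm_iteratedFDeriv_two_div_one_add_sq_le hε _)

lemma SteinHyp.lintegral_inner_sq_le [IsProbabilityMeasure ν] (hν : SteinHyp ν H α) (n : ℕ) :
    ∫⁻ x, ENNReal.ofReal (⟪xb n, x⟫ ^ 2) ∂ν ≤ ENNReal.ofReal (‖H n‖ ^ 2) := by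
  have hε : Tendsto (fun m : ℕ => 1 / ((m : ℝ) + 1)) atTop (nhds 0) :=
    tendsto_one_div_add_atTop_nhds_zero_nat
  have hlim : ∀ x : l2, Tendsto (fun m : ℕ => ENNReal.ofReal
      (⟪xb n, x⟫ ^ 2 / (1 + (1 / ((m : ℝ) + 1)) ^ 2 * ⟪xb n, x⟫ ^ 2))) atTop
      (nhds (ENNReal.ofReal (⟪xb n, x⟫ ^ 2))) := fun x => by
    refine ENNReal.tendsto_ofReal ?_
    have h := (tendsto_const_nhds (x := ⟪xb n, x⟫ ^ 2)).div
      (((hε.pow 2).mul_const (⟪xb n, x⟫ ^ 2)).const_add 1) (by simp)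
    simp only [ne_eq, OfNat.ofNat_ne_zero, not_false_eq_true, zero_pow, zero_mul, add_zero,
      div_one] at h
    exact h
  have hcont : ∀ ε : ℝ, Continuous fun x : l2 => ⟪xb n, x⟫ ^ 2 / (1 + ε ^ 2 * ⟪xb n, x⟫ ^ 2) :=
    fun ε => (by fun_prop : Continuous fun x : l2 => ⟪xb n, x⟫ ^ 2).div
      (by fun_prop) fun x => by positivity
  have hb : ∀ m : ℕ, ∫⁻ x, ENNReal.ofReal
      (⟪xb n, x⟫ ^ 2 / (1 + (1 / ((m : ℝ) + 1)) ^ 2 * ⟪xb n, x⟫ ^ 2)) ∂ν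
      ≤ ENNReal.ofReal (‖H n‖ ^ 2 + α * (6 * (1 / ((m : ℝ) + 1)))) := fun m => by
    have hm : 0 < 1 / ((m : ℝ) + 1) := by positivity
    rw [← ofReal_integral_eq_lintegral_ofReal]
    · exact ENNReal.ofReal_le_ofReal (hν.integral_div_one_add_sq_le n hm)
    · refine (integrable_const (((m : ℝ) + 1) ^ 2)).mono' (hcont _).aestronglyMeasurable
        (ae_of_all _ fun x => ?_)
      rw [Real.norm_eq_abs, abs_of_nonneg (by positivity), div_le_iff₀ (by positivity)]
      have : ((m : ℝ) + 1) ^ 2 * (1 + (1 / ((m : ℝ) + 1)) ^ 2 * ⟪xb n, x⟫ ^ 2)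
          = ((m : ℝ) + 1) ^ 2 + ⟪xb n, x⟫ ^ 2 := by
        field_simp
      rw [this]
      linarith [sq_nonneg ((m : ℝ) + 1)]
    · exact ae_of_all _ fun x => by positivity
  calc ∫⁻ x, ENNReal.ofReal (⟪xb n, x⟫ ^ 2) ∂ν
      = ∫⁻ x, liminf (fun m : ℕ => ENNReal.ofReal
          (⟪xb n, x⟫ ^ 2 / (1 + (1 / ((m : ℝ) + 1)) ^ 2 * ⟪xb n, x⟫ ^ 2))) atTop ∂ν := by
        congr with x
        exact (hlim x).liminf_eq.symm
    _ ≤ liminf (fun m : ℕ => ∫⁻ x, ENNReal.ofReal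
          (⟪xb n, x⟫ ^ 2 / (1 + (1 / ((m : ℝ) + 1)) ^ 2 * ⟪xb n, x⟫ ^ 2)) ∂ν) atTop :=
        lintegral_liminf_le fun m => (hcont _).measurable.ennreal_ofReal
    _ ≤ liminf (fun m : ℕ => ENNReal.ofReal (‖H n‖ ^ 2 + α * (6 * (1 / ((m : ℝ) + 1))))) atTop :=
        liminf_le_liminf (Eventually.of_forall hb)
    _ = ENNReal.ofReal (‖H n‖ ^ 2) := by
        refine Tendsto.liminf_eq (ENNReal.tendsto_ofReal ?_)
        simpa using ((hε.const_mul 6).const_mul α).const_add (‖H n‖ ^ 2)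

/-- A measure satisfying the Stein hypothesis with a square-summable family has finite second
moment. -/
lemma SteinHyp.memLp_two [IsProbabilityMeasure ν] (hν : SteinHyp ν H α)
    (hH : Summable fun n => ‖H n‖ ^ 2) : MemLp id 2 ν := by
  refine ⟨continuous_id.aestronglyMeasurable, ?_⟩
  rw [eLpNorm_lt_top_iff_lintegral_rpow_enorm_lt_top two_ne_zero ENNReal.ofNat_ne_top]
  have h1 : ∀ x : l2, ‖id x‖ₑ ^ (2 : ℝ≥0∞).toReal = ∑' n, ENNReal.ofReal (⟪xb n, x⟫ ^ 2) :=
    fun x => by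
      rw [← ENNReal.ofReal_tsum_of_nonneg (fun n => sq_nonneg _) (hasSum_inner_xb_sq x).summable,
        (hasSum_inner_xb_sq x).tsum_eq, ENNReal.ofReal_pow (norm_nonneg _), ofReal_norm]
      simp
  simp only [h1]
  rw [lintegral_tsum fun n => by fun_prop]
  refine (ENNReal.tsum_le_tsum fun n => hν.lintegral_inner_sq_le n).trans_lt ?_
  rw [← ENNReal.ofReal_tsum_of_nonneg (fun n => sq_nonneg _) hH]
  exact ENNReal.ofReal_lt_top

end Stein

section TraceNorm

lemma sum_abs_inner_le_traceNormE {T : l2 →L[ℝ] l2} (hT : traceNormE T ≠ ⊤)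
    (b : HilbertBasis ℕ ℝ l2) (s : Finset ℕ) :
    ∑ n ∈ s, |⟪T (b n), b n⟫| ≤ (traceNormE T).toReal := by
  rw [← ENNReal.ofReal_le_iff_le_toReal hT, ENNReal.ofReal_sum_of_nonneg fun n _ => abs_nonneg _]
  calc ∑ n ∈ s, ENNReal.ofReal |⟪T (b n), b n⟫|
      = ∑ n ∈ s, (‖⟪T (b n), b n⟫‖₊ : ℝ≥0∞) :=
        Finset.sum_congr rfl fun n _ => Real.enorm_eq_ofReal_abs _ |>.symm
    _ ≤ ∑' n, (‖⟪T (b n), b n⟫‖₊ : ℝ≥0∞) := ENNReal.sum_le_tsum s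
    _ ≤ traceNormE T := le_iSup₂_of_le b b le_rfl

/-- An orthonormal basis of `ℝᴺ` extends to a Hilbert basis of `ℓ²(ℕ)`. -/
lemma exists_hilbertBasis_extending {N : ℕ}
    (f : OrthonormalBasis (Fin N) ℝ (EuclideanSpace ℝ (Fin N))) :
    ∃ b : HilbertBasis ℕ ℝ l2, ∀ i : Fin N, b i = l2emb N (f i) := by
  set v : ℕ → l2 := fun n => if hn : n < N then l2emb N (f ⟨n, hn⟩) else xb n with hv
  have hlt : ∀ i : Fin N, v i = l2emb N (f i) := fun i => by simp [hv]
  have hge : ∀ n, N ≤ n → v n = xb n := fun n hn => by simp [hv, not_lt.2 hn]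
  have hort : Orthonormal ℝ v := by
    rw [orthonormal_iff_ite]
    intro m n
    rcases lt_or_ge m N with hm | hm <;> rcases lt_or_ge n N with hn | hn
    · rw [hlt ⟨m, hm⟩, hlt ⟨n, hn⟩, LinearIsometry.inner_map_map,
        orthonormal_iff_ite.1 f.orthonormal]
      simp
    · rw [hlt ⟨m, hm⟩, hge n hn, inner_l2emb, l2proj_xb_of_le hn, inner_zero_right,
        if_neg (by omega)]
    · rw [hge m hm, hlt ⟨n, hn⟩, real_inner_comm, inner_l2emb, l2proj_xb_of_le hm,
        inner_zero_right, if_neg (by omega)]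
    · rw [hge m hm, hge n hn, orthonormal_iff_ite.1 orthonormal_xb]
  have hsp : (Submodule.span ℝ (Set.range v))ᗮ = ⊥ := by
    rw [Submodule.eq_bot_iff]
    intro x hx
    have h0 : ∀ n, ⟪v n, x⟫ = 0 := fun n =>
      (Submodule.mem_orthogonal _ x).1 hx _ (Submodule.subset_span ⟨n, rfl⟩)
    have hp : l2proj N x = 0 := InnerProductSpace.ext_inner_left_basis f.toBasis fun i => by
      rw [OrthonormalBasis.coe_toBasis, ← inner_l2emb, ← hlt, h0, inner_zero_right]
    have hc : ∀ n, ⟪xb n, x⟫ = 0 := fun n => by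
      rcases lt_or_ge n N with hn | hn
      · rw [← l2proj_apply x ⟨n, hn⟩, hp]
        rfl
      · rw [← hge n hn, h0]
    have hs := hasSum_inner_xb_smul x
    simp only [hc, zero_smul] at hs
    exact hs.unique hasSum_zero
  refine ⟨HilbertBasis.mkOfOrthogonalEqBot hort hsp, fun i => ?_⟩
  rw [HilbertBasis.coe_mkOfOrthogonalEqBot, hlt]

variable {X Y : Type*} [NormedAddCommGroup X] [InnerProductSpace ℝ X] [NormedAddCommGroup Y]
  [InnerProductSpace ℝ Y] {T : l2 →L[ℝ] l2} {H : ℕ → X} {h : ℕ → Y}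

lemma abs_gramTrace_sub_le
    (hT : ∀ n k : ℕ, ⟪T (xb k), xb n⟫ = ⟪H n, H k⟫ - ⟪h n, h k⟫) (hfin : traceNormE T ≠ ⊤) (N : ℕ)
    (A : EuclideanSpace ℝ (Fin N) →L[ℝ] EuclideanSpace ℝ (Fin N)) :
    |gramTrace H N A - gramTrace h N A| ≤ (traceNormE T).toReal * ‖A‖ := by
  obtain ⟨τ, hτi⟩ : ∃ τ : EuclideanSpace ℝ (Fin N) →ₗ[ℝ] EuclideanSpace ℝ (Fin N),
      ∀ v w, ⟪τ v, w⟫ = ⟪T (l2emb N v), l2emb N w⟫ := by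
    refine ⟨(l2proj N ∘L T ∘L (l2emb N).toContinuousLinearMap).toLinearMap, fun v w => ?_⟩
    rw [real_inner_comm, real_inner_comm (l2emb N w), inner_l2emb]
    rfl
  have hsymm : τ.IsSymmetric := fun v w => by
    rw [real_inner_comm (τ w)]
    have hh : ∀ v w, ⟪τ v, w⟫ = ∑ k : Fin N, ∑ n : Fin N, v k * w n * (⟪H n, H k⟫ - ⟪h n, h k⟫) :=
      fun v w => by
        rw [hτi, l2emb_apply, l2emb_apply, map_sum, sum_inner]
        refine Finset.sum_congr rfl fun k _ => ?_
        rw [inner_sum]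
        refine Finset.sum_congr rfl fun n _ => ?_
        rw [map_smul, real_inner_smul_left, real_inner_smul_right, hT]
        ring
    rw [hh, hh, Finset.sum_comm]
    refine Finset.sum_congr rfl fun k _ => Finset.sum_congr rfl fun n _ => ?_
    rw [real_inner_comm (H n), real_inner_comm (h n)]
    ring
  have htr : gramTrace H N A - gramTrace h N A = LinearMap.trace ℝ _ (τ ∘ₗ A.toLinearMap) := by
    rw [LinearMap.trace_eq_sum_inner _ (EuclideanSpace.basisFun (Fin N) ℝ), gramTrace_apply,
      gramTrace_apply, ← Finset.sum_sub_distrib]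
    refine Finset.sum_congr rfl fun n _ => ?_
    rw [← Finset.sum_sub_distrib, EuclideanSpace.basisFun_apply, LinearMap.comp_apply,
      ContinuousLinearMap.coe_coe, real_inner_comm, hτi, l2emb_single, l2emb_apply, map_sum,
      sum_inner]
    refine Finset.sum_congr rfl fun k _ => ?_
    rw [map_smul, real_inner_smul_left, hT]
    ring
  have hn : Module.finrank ℝ (EuclideanSpace ℝ (Fin N)) = N := by simp
  set f := hsymm.eigenvectorBasis hn
  obtain ⟨b, hb⟩ := exists_hilbertBasis_extending f
  rw [htr, LinearMap.trace_eq_sum_inner _ f]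
  have hterm : ∀ i, |⟪f i, (τ ∘ₗ A.toLinearMap) (f i)⟫| ≤ |⟪T (b i), b i⟫| * ‖A‖ := fun i => by
    rw [LinearMap.comp_apply, ← hsymm, ContinuousLinearMap.coe_coe, hb, ← hτi,
      hsymm.apply_eigenvectorBasis, real_inner_smul_left, real_inner_smul_left, abs_mul, abs_mul,
      real_inner_self_eq_norm_sq, f.norm_eq_one, one_pow, abs_one, mul_one]
    refine mul_le_mul_of_nonneg_left ?_ (abs_nonneg _)
    refine (abs_real_inner_le_norm _ _).trans ?_
    simpa using A.le_opNorm (f i)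
  calc |∑ i, ⟪f i, (τ ∘ₗ A.toLinearMap) (f i)⟫|
      ≤ ∑ i, |⟪f i, (τ ∘ₗ A.toLinearMap) (f i)⟫| := Finset.abs_sum_le_sum_abs _ _
    _ ≤ ∑ i : Fin N, |⟪T (b i), b i⟫| * ‖A‖ := Finset.sum_le_sum fun i _ => hterm i
    _ = (∑ i ∈ Finset.range N, |⟪T (b i), b i⟫|) * ‖A‖ := by
        rw [← Finset.sum_mul, Fin.sum_univ_eq_sum_range fun n => |⟪T (b n), b n⟫|]
    _ ≤ (traceNormE T).toReal * ‖A‖ :=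
        mul_le_mul_of_nonneg_right (sum_abs_inner_le_traceNormE hfin b _) (norm_nonneg _)

lemma summable_norm_sq_of_traceNormE
    (hT : ∀ n k : ℕ, ⟪T (xb k), xb n⟫ = ⟪H n, H k⟫ - ⟪h n, h k⟫) (hfin : traceNormE T ≠ ⊤)
    (hh : Summable fun n => ‖h n‖ ^ 2) : Summable fun n => ‖H n‖ ^ 2 := by
  have h1 : Summable fun n => ⟪T (xb n), xb n⟫ := by
    refine Summable.of_abs (summable_of_sum_le (fun n => abs_nonneg _)
      (c := (traceNormE T).toReal) fun s => ?_)
    simpa only [xbBasis_apply] using sum_abs_inner_le_traceNormE hfin xbBasis s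
  refine (h1.add hh).congr fun n => ?_
  rw [hT, real_inner_self_eq_norm_sq, real_inner_self_eq_norm_sq, sub_add_cancel]

end TraceNorm

section Assembly

lemma lipschitzWith_one_of_iteratedFDeriv {E : Type*} [NormedAddCommGroup E] [NormedSpace ℝ E]
    {f : E → ℝ} (hf : ContDiff ℝ 1 f) (hf1 : ∀ x, ‖iteratedFDeriv ℝ 1 f x‖ ≤ 1) :
    LipschitzWith 1 f :=
  lipschitzWith_of_nnnorm_fderiv_le (hf.differentiable one_ne_zero) fun x => by
    have h := hf1 x
    rwa [norm_iteratedFDeriv_one] at h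

lemma LipschitzWith.abs_le_add_norm {E : Type*} [NormedAddCommGroup E] {f : E → ℝ}
    (hf : LipschitzWith 1 f) (x : E) : |f x| ≤ |f 0| + ‖x‖ := by
  have h := hf.norm_sub_le x 0
  rw [NNReal.coe_one, one_mul, sub_zero, Real.norm_eq_abs] at h
  linarith [abs_sub_abs_le_abs_sub (f x) (f 0)]

lemma LipschitzWith.integrable_of_integrable_id {E : Type*} [NormedAddCommGroup E]
    [MeasurableSpace E] [BorelSpace E] [SecondCountableTopology E] {μ : Measure E}
    [IsProbabilityMeasure μ] {f : E → ℝ} (hf : LipschitzWith 1 f) (hμ : Integrable id μ) :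
    Integrable f μ :=
  ((integrable_const |f 0|).add hμ.norm).mono' hf.continuous.aestronglyMeasurable
    (ae_of_all _ hf.abs_le_add_norm)

lemma integrable_id_map_l2proj {ν : Measure l2} (hν : Integrable id ν) (N : ℕ) :
    Integrable id (ν.map (l2proj N)) :=
  (integrable_map_measure continuous_id.aestronglyMeasurable (by fun_prop)).2
    ((l2proj N).integrable_comp hν)

lemma rho_le {ν μ : Measure l2} {j : ℕ} {c : ℝ} (hc : 0 ≤ c)
    (h : ∀ F : l2 → ℝ, ContDiff ℝ j F →
      (∀ i : ℕ, 1 ≤ i → i ≤ j → ∀ x, ‖iteratedFDeriv ℝ i F x‖ ≤ 1) →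
      ∫ x, F x ∂ν - ∫ x, F x ∂μ ≤ c) : rho j ν μ ≤ c := by
  refine Real.sSup_le ?_ hc
  rintro r ⟨F, hF, hb, rfl⟩
  exact h F hF hb

lemma tendsto_integral_map_l2proj {ν : Measure l2} [IsProbabilityMeasure ν] (hν : Integrable id ν)
    {F : l2 → ℝ} (hF : LipschitzWith 1 F) :
    Tendsto (fun N => ∫ x, F (l2emb N x) ∂(ν.map (l2proj N))) atTop (nhds (∫ x, F x ∂ν)) := by
  have h1 : ∀ N, ∫ x, F (l2emb N x) ∂(ν.map (l2proj N)) = ∫ x, F (l2emb N (l2proj N x)) ∂ν :=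
    fun N => integral_map (by fun_prop)
      (hF.continuous.comp (l2emb N).continuous).aestronglyMeasurable
  simp only [h1]
  refine tendsto_integral_of_dominated_convergence (fun x => |F 0| + ‖x‖) (fun N => ?_)
    ((integrable_const _).add hν.norm) (fun N => ae_of_all _ fun x => ?_)
    (ae_of_all _ fun x => (hF.continuous.tendsto x).comp (tendsto_l2emb_l2proj x))
  · exact (hF.continuous.comp
      ((l2emb N).continuous.comp (l2proj N).continuous)).aestronglyMeasurable
  · refine (hF.abs_le_add_norm _).trans ?_
    rw [LinearIsometry.norm_map]
    linarith [norm_l2proj_apply_le (N := N) x]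

variable {X Y : Type*} [NormedAddCommGroup X] [InnerProductSpace ℝ X] [NormedAddCommGroup Y]
  [InnerProductSpace ℝ Y] {T : l2 →L[ℝ] l2} {H : ℕ → X} {h : ℕ → Y} {ν μ : Measure l2}
  [IsProbabilityMeasure ν] [IsProbabilityMeasure μ] {α : ℝ}

lemma SteinHyp.integrable_id (hν : SteinHyp ν H α) (hμ : HasGramCharFun μ h)
    (hT : ∀ n k : ℕ, ⟪T (xb k), xb n⟫ = ⟪H n, H k⟫ - ⟪h n, h k⟫) (hfin : traceNormE T ≠ ⊤) :
    Integrable id ν :=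
  (hν.memLp_two (summable_norm_sq_of_traceNormE hT hfin hμ.summable)).integrable one_le_two

lemma SteinHyp.integral_map_sub_le (hν : SteinHyp ν H α) (hμ : HasGramCharFun μ h)
    (hT : ∀ n k : ℕ, ⟪T (xb k), xb n⟫ = ⟪H n, H k⟫ - ⟪h n, h k⟫) (hfin : traceNormE T ≠ ⊤)
    {N : ℕ} {f : EuclideanSpace ℝ (Fin N) → ℝ} (hf : ContDiff ℝ 3 f)
    (hf1 : ∀ x, ‖iteratedFDeriv ℝ 1 f x‖ ≤ 1) (hf2 : ∀ x, ‖iteratedFDeriv ℝ 2 f x‖ ≤ 1)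
    {C : ℝ} (hf3 : ∀ x, ‖iteratedFDeriv ℝ 3 f x‖ ≤ C) :
    ∫ x, f x ∂(ν.map (l2proj N)) - ∫ x, f x ∂(μ.map (l2proj N))
      ≤ 1 / 2 * (traceNormE T).toReal + α * C / 3 := by
  have := hμ.isGaussian
  have := Measure.isProbabilityMeasure_map (μ := ν) (l2proj N).measurable.aemeasurable
  have := Measure.isProbabilityMeasure_map (μ := μ) (l2proj N).measurable.aemeasurable
  exact integral_sub_integral_le_of_stein
    (integrable_id_map_l2proj (hν.integrable_id hμ hT hfin) N)
    (integrable_id_map_l2proj IsGaussian.integrable_id N)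
    (fun g hg hb C2 hC2 => hν.map_l2proj N hg hb C2 hC2)
    (fun g hg ⟨_, hC⟩ ⟨_, hC'⟩ => hμ.integral_inner_eq N hg hC hC')
    ENNReal.toReal_nonneg (abs_gramTrace_sub_le hT hfin N) hf hf1 hf2 hf3

lemma SteinHyp.integral_map_sub_le_of_zero (hν : SteinHyp ν H 0) (hμ : HasGramCharFun μ h)
    (hT : ∀ n k : ℕ, ⟪T (xb k), xb n⟫ = ⟪H n, H k⟫ - ⟪h n, h k⟫) (hfin : traceNormE T ≠ ⊤)
    {N : ℕ} {f : EuclideanSpace ℝ (Fin N) → ℝ} (hf : ContDiff ℝ 2 f)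
    (hf1 : ∀ x, ‖iteratedFDeriv ℝ 1 f x‖ ≤ 1) (hf2 : ∀ x, ‖iteratedFDeriv ℝ 2 f x‖ ≤ 1) :
    ∫ x, f x ∂(ν.map (l2proj N)) - ∫ x, f x ∂(μ.map (l2proj N))
      ≤ 1 / 2 * (traceNormE T).toReal := by
  have := hμ.isGaussian
  refine le_of_forall_pos_le_add fun ε hε => ?_
  obtain ⟨g, hg, hg1, hg2, ⟨C, hg3⟩, hgf⟩ :=
    exists_contDiff_three_approx hf hf1 hf2 (half_pos hε)
  have h1 := hν.integral_map_sub_le hμ hT hfin hg hg1 hg2 hg3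
  have h2 : ∀ κ : Measure l2, IsProbabilityMeasure κ → Integrable id κ →
      |∫ x, g x ∂(κ.map (l2proj N)) - ∫ x, f x ∂(κ.map (l2proj N))| ≤ ε / 2 := fun κ _ hκ => by
    have := Measure.isProbabilityMeasure_map (μ := κ) (l2proj N).measurable.aemeasurable
    have hκ' := integrable_id_map_l2proj hκ N
    rw [← integral_sub
      ((lipschitzWith_one_of_iteratedFDeriv (hg.of_le (by norm_num)) hg1)
        |>.integrable_of_integrable_id hκ')
      ((lipschitzWith_one_of_iteratedFDeriv (hf.of_le (by norm_num)) hf1)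
        |>.integrable_of_integrable_id hκ')]
    exact abs_integral_le_of_forall_le hgf
  have h3 := abs_le.1 (h2 ν inferInstance (hν.integrable_id hμ hT hfin))
  have h4 := abs_le.1 (h2 μ inferInstance IsGaussian.integrable_id)
  linarith [h3.1, h4.2]

lemma norm_iteratedFDeriv_comp_l2emb_le {n : ℕ} {F : l2 → ℝ} (hF : ContDiff ℝ n F) {C : ℝ}
    (hC : ∀ x, ‖iteratedFDeriv ℝ n F x‖ ≤ C) {N : ℕ} (x : EuclideanSpace ℝ (Fin N)) :
    ‖iteratedFDeriv ℝ n (F ∘ l2emb N) x‖ ≤ C := by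
  refine (norm_iteratedFDeriv_comp_right_le hF (l2emb N).toContinuousLinearMap x).trans ?_
  exact (mul_le_of_le_one_right (norm_nonneg _)
    (pow_le_one₀ (norm_nonneg _) (l2emb N).norm_toContinuousLinearMap_le)).trans (hC _)

/-- A bound on the finite-dimensional marginals passes to the limit. -/
lemma integral_sub_le_of_map_l2proj (hν : Integrable id ν) (hμ : Integrable id μ) {F : l2 → ℝ}
    (hF : LipschitzWith 1 F) {c : ℝ}
    (hc : ∀ N, ∫ x, (F ∘ l2emb N) x ∂(ν.map (l2proj N)) -
      ∫ x, (F ∘ l2emb N) x ∂(μ.map (l2proj N)) ≤ c) :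
    ∫ x, F x ∂ν - ∫ x, F x ∂μ ≤ c :=
  le_of_tendsto ((tendsto_integral_map_l2proj hν hF).sub (tendsto_integral_map_l2proj hμ hF))
    (Eventually.of_forall hc)

end Assembly

theorem stein_method_bound
    {X : Type} [NormedAddCommGroup X] [InnerProductSpace ℝ X] [CompleteSpace X]
    (β : ℝ) (hβ0 : 0 < β) (hβ : β < 1 / 2)
    (e : HilbertBasis ℕ ℝ L2)
    -- h n = h_n^{1−β} = I^{1−β}_{1^-}(e_n)
    (h : ℕ → L2)
    (hh : ∀ n, ∀ᵐ x ∂μ01, h n x = Ifrac β ((e n : L2) : ℝ → ℝ) x)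
    -- m_β : the centered Gaussian measure on l²(ℕ) with covariance S_β
    (mβ : Measure l2) [IsProbabilityMeasure mβ]
    (hmβ : ∀ v : l2,
      ∫ u, Complex.exp (Complex.I * ((⟪v, u⟫ : ℝ) : ℂ)) ∂mβ
        = Complex.exp (-(1/2 : ℂ) *
            ((∑' n, ∑' k, ⟪h n, h k⟫ * (↑v : ∀ _ : ℕ, ℝ) n * (↑v : ∀ _ : ℕ, ℝ) k : ℝ) : ℂ)))
    -- ν satisfies Hyp(X, H, α)
    (ν : Measure l2) [IsProbabilityMeasure ν]
    (H : ℕ → X) (α : ℝ) (hα : 0 ≤ α)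
    (hHyp : SteinHyp ν H α)
    -- T is the operator trace_X(H⊗H) − S_β on l²(ℕ)
    (T : l2 →L[ℝ] l2)
    (hT : ∀ n k : ℕ, ⟪T (xb k), xb n⟫ = ⟪H n, H k⟫ - ⟪h n, h k⟫)
    (hfin : traceNormE T ≠ ⊤) :
    (0 < α → rho 3 ν mβ ≤ (1/2) * (traceNormE T).toReal + α / 3) ∧
    (α = 0 → rho 2 ν mβ ≤ (1/2) * (traceNormE T).toReal) := by
  have hμ : HasGramCharFun mβ h := fun v => by
    rw [charFun_apply]
    convert hmβ v using 1
    · congr with u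
      rw [real_inner_comm, mul_comm]
    · congr 1
      rw [gramForm]
      push_cast
      ring
  have := hμ.isGaussian
  have hνi := hHyp.integrable_id hμ hT hfin
  have hμi : Integrable id mβ := IsGaussian.integrable_id
  refine ⟨fun _ => rho_le (by positivity) fun F hF hb => ?_,
    fun hα0 => rho_le (by positivity) fun F hF hb => ?_⟩
  · have hF3 : ContDiff ℝ 3 F := hF
    have hF2 : ContDiff ℝ 2 F := hF3.of_le (by norm_num)
    have hF1 : ContDiff ℝ 1 F := hF3.of_le (by norm_num)
    refine integral_sub_le_of_map_l2proj hνi hμi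
      (lipschitzWith_one_of_iteratedFDeriv hF1 (hb 1 le_rfl (by norm_num))) fun N => ?_
    have h1 := hHyp.integral_map_sub_le hμ hT hfin (hF3.comp (l2emb N).contDiff)
      (norm_iteratedFDeriv_comp_l2emb_le hF1 (hb 1 le_rfl (by norm_num)))
      (norm_iteratedFDeriv_comp_l2emb_le hF2 (hb 2 (by norm_num) (by norm_num)))
      (norm_iteratedFDeriv_comp_l2emb_le hF3 (hb 3 (by norm_num) le_rfl))
    rwa [mul_one] at h1
  · subst hα0
    have hF2 : ContDiff ℝ 2 F := hF
    have hF1 : ContDiff ℝ 1 F := hF2.of_le (by norm_num)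
    refine integral_sub_le_of_map_l2proj hνi hμi
      (lipschitzWith_one_of_iteratedFDeriv hF1 (hb 1 le_rfl (by norm_num))) fun N => ?_
    exact hHyp.integral_map_sub_le_of_zero hμ hT hfin (hF2.comp (l2emb N).contDiff)
      (norm_iteratedFDeriv_comp_l2emb_le hF1 (hb 1 le_rfl (by norm_num)))
      (norm_iteratedFDeriv_comp_l2emb_le hF2 (hb 2 (by norm_num) le_rfl))
end
end

section
/- Let X_λ be a Poisson random variable of parameter λ > 0, X̃_λ = (X_λ − λ)/√λ, and Z a standard Gaussian random variable. Then the Wasserstein distance dist_W(X̃_λ, Z) := sup{ E[F(X̃_λ)] − E[F(Z)] : F : ℝ → ℝ 1-Lipschitz } satisfies dist_W(X̃_λ, Z) ≤ 1/√λ. -/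
/- Statement 13: Stein bound for the normal approximation of a normalized Poisson
random variable: dist_W((X_λ−λ)/√λ, N(0,1)) ≤ 1/√λ, the Wasserstein distance being
the supremum of E[F(X̃_λ)] − E[F(Z)] over 1-Lipschitz F. -/

open MeasureTheory ProbabilityTheory Filter
open scoped ENNReal NNReal Classical

noncomputable section

/-- The density of the standard Gaussian law solves `φ' = -x φ`. -/
lemma hasDerivAt_stdGaussianPDF (x : ℝ) :
    HasDerivAt (gaussianPDFReal 0 1) (-x * gaussianPDFReal 0 1 x) x := by
  have h : HasDerivAt (fun y : ℝ => -(y - 0) ^ 2 / (2 * ((1 : ℝ≥0) : ℝ))) (-x) x := by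
    have h' := (((hasDerivAt_id x).sub_const 0).pow 2).neg.div_const (2 * ((1 : ℝ≥0) : ℝ))
    exact h'.congr_deriv (by simp; ring)
  have h2 := (h.exp).const_mul (Real.sqrt (2 * Real.pi * ((1 : ℝ≥0) : ℝ)))⁻¹
  rw [gaussianPDFReal_def]
  exact h2.congr_deriv (by ring)

lemma stdGaussianPDF_neg (x : ℝ) : gaussianPDFReal 0 1 (-x) = gaussianPDFReal 0 1 x := by
  simp [gaussianPDFReal]

lemma continuous_stdGaussianPDF : Continuous (gaussianPDFReal 0 1) :=
  continuous_iff_continuousAt.2 fun x => (hasDerivAt_stdGaussianPDF x).continuousAt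

lemma stdGaussianPDF_pos (x : ℝ) : 0 < gaussianPDFReal 0 1 x :=
  gaussianPDFReal_pos 0 1 x one_ne_zero

lemma tendsto_stdGaussianPDF_cocompact :
    Tendsto (gaussianPDFReal 0 1) (cocompact ℝ) (nhds 0) := by
  have h : Tendsto (fun x : ℝ => x ^ 2 / 2) (cocompact ℝ) atTop := by
    have h1 := (tendsto_pow_atTop (two_ne_zero)).comp (tendsto_norm_cocompact_atTop (E := ℝ))
    have h2 := h1.atTop_div_const (two_pos)
    exact h2.congr fun x => by simp
  have h2 := (Real.tendsto_exp_neg_atTop_nhds_zero.comp h).const_mul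
    (Real.sqrt (2 * Real.pi))⁻¹
  rw [mul_zero] at h2
  refine h2.congr fun x => ?_
  simp [gaussianPDFReal, neg_div]

lemma integrable_mul_stdGaussianPDF_iff {w : ℝ → ℝ} :
    Integrable (fun t => w t * gaussianPDFReal 0 1 t) ↔ Integrable w (gaussianReal 0 1) := by
  rw [gaussianReal_of_var_ne_zero 0 one_ne_zero,
    integrable_withDensity_iff (measurable_gaussianPDF 0 1)
      (.of_forall fun _ => gaussianPDF_lt_top)]
  simp [toReal_gaussianPDF]

lemma integral_mul_stdGaussianPDF (w : ℝ → ℝ) :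
    ∫ t, w t * gaussianPDFReal 0 1 t = ∫ t, w t ∂(gaussianReal 0 1) := by
  rw [integral_gaussianReal_eq_integral_smul one_ne_zero]
  simp [mul_comm]

lemma integral_Iic_id_mul_stdGaussianPDF (x : ℝ) :
    ∫ t in Set.Iic x, t * gaussianPDFReal 0 1 t = -gaussianPDFReal 0 1 x := by
  have hint : Integrable (fun t : ℝ => t * gaussianPDFReal 0 1 t) :=
    integrable_mul_stdGaussianPDF_iff.2
      ((memLp_id_gaussianReal (μ := 0) (v := 1) 1).integrable (by simp))
  have h := integral_Iic_of_hasDerivAt_of_tendsto' (a := x) (m := 0)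
    (f := fun t => -gaussianPDFReal 0 1 t) (f' := fun t => t * gaussianPDFReal 0 1 t)
    (fun t _ => (hasDerivAt_stdGaussianPDF t).neg.congr_deriv (by ring)) hint.integrableOn
    (by simpa using (tendsto_stdGaussianPDF_cocompact.mono_left atBot_le_cocompact).neg)
  simpa using h

/-- Lower bound on the Mills ratio of the Gaussian law. -/
lemma mul_stdGaussianPDF_le_integral_Ioi (x : ℝ) :
    x * gaussianPDFReal 0 1 x ≤ (1 + x ^ 2) * ∫ t in Set.Ioi x, gaussianPDFReal 0 1 t := by
  have hpos : ∀ t : ℝ, 0 < 1 + t ^ 2 := fun t => by positivity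
  have hderiv : ∀ t : ℝ, HasDerivAt (fun t => -(t / (1 + t ^ 2)) * gaussianPDFReal 0 1 t)
      ((1 - 2 / (1 + t ^ 2) ^ 2) * gaussianPDFReal 0 1 t) t := by
    intro t
    have h1 := ((hasDerivAt_id t).div (((hasDerivAt_id t).pow 2).const_add 1) (hpos t).ne').neg.mul
      (hasDerivAt_stdGaussianPDF t)
    refine h1.congr_deriv ?_
    have := (hpos t).ne'
    simp
    field_simp
    ring
  have hint : Integrable (fun t : ℝ => (1 - 2 / (1 + t ^ 2) ^ 2) * gaussianPDFReal 0 1 t) := by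
    refine (integrable_gaussianPDFReal 0 1).bdd_mul (c := 1) ?_ (.of_forall fun t => ?_)
    · exact Continuous.aestronglyMeasurable (by
        refine continuous_const.sub (continuous_const.div (by fun_prop) fun t => ?_)
        have := hpos t
        positivity)
    · have h1 : 1 ≤ (1 + t ^ 2) ^ 2 := by nlinarith [sq_nonneg t]
      have h2 : 2 / (1 + t ^ 2) ^ 2 ≤ 2 := div_le_self (by norm_num) h1
      have h3 : 0 ≤ 2 / (1 + t ^ 2) ^ 2 := by positivity
      rw [Real.norm_eq_abs, abs_le]
      constructor <;> linarith
  have hlim : Tendsto (fun t : ℝ => -(t / (1 + t ^ 2)) * gaussianPDFReal 0 1 t) atTop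
      (nhds 0) := by
    refine squeeze_zero_norm (fun t => ?_)
      (tendsto_stdGaussianPDF_cocompact.mono_left atTop_le_cocompact)
    rw [norm_mul, norm_neg, Real.norm_of_nonneg (stdGaussianPDF_pos t).le]
    refine mul_le_of_le_one_left (stdGaussianPDF_pos t).le ?_
    rw [Real.norm_eq_abs, abs_div, abs_of_pos (hpos t), div_le_one (hpos t), abs_le]
    constructor <;> nlinarith [sq_nonneg (t - 1), sq_nonneg (t + 1)]
  have h := integral_Ioi_of_hasDerivAt_of_tendsto' (a := x) (fun t _ => hderiv t)
    hint.integrableOn hlim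
  have hle : ∫ t in Set.Ioi x, (1 - 2 / (1 + t ^ 2) ^ 2) * gaussianPDFReal 0 1 t
      ≤ ∫ t in Set.Ioi x, gaussianPDFReal 0 1 t := by
    refine integral_mono hint.integrableOn (integrable_gaussianPDFReal 0 1).integrableOn
      fun t => mul_le_of_le_one_left (stdGaussianPDF_pos t).le ?_
    have : 0 ≤ 2 / (1 + t ^ 2) ^ 2 := by positivity
    linarith
  rw [h] at hle
  have h2 := mul_le_mul_of_nonneg_left hle (hpos x).le
  refine le_trans (le_of_eq ?_) h2
  have := (hpos x).ne'
  field_simp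
  ring

lemma neg_mul_stdGaussianPDF_le_integral_Iic (x : ℝ) :
    -x * gaussianPDFReal 0 1 x ≤ (1 + x ^ 2) * ∫ t in Set.Iic x, gaussianPDFReal 0 1 t := by
  have h := mul_stdGaussianPDF_le_integral_Ioi (-x)
  have h2 := integral_comp_neg_Iic x (gaussianPDFReal 0 1)
  simp only [stdGaussianPDF_neg] at h h2
  rwa [h2, ← neg_sq x]

lemma stein_nonpos_of_monotone {w : ℝ → ℝ} (hw : Monotone w)
    (hint : Integrable (fun t => w t * gaussianPDFReal 0 1 t))
    (hzero : ∫ t, w t * gaussianPDFReal 0 1 t = 0) (x : ℝ) :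
    (1 + x ^ 2) * (∫ t in Set.Iic x, w t * gaussianPDFReal 0 1 t)
      + x * (w x * gaussianPDFReal 0 1 x) ≤ 0 := by
  have hpos : 0 < 1 + x ^ 2 := by positivity
  have hφ := integrable_gaussianPDFReal 0 1
  rcases le_total 0 (w x) with h | h
  · have hsum : (∫ t in Set.Iic x, w t * gaussianPDFReal 0 1 t)
        + ∫ t in Set.Ioi x, w t * gaussianPDFReal 0 1 t = 0 := by
      rw [intervalIntegral.integral_Iic_add_Ioi hint.integrableOn hint.integrableOn, hzero]
    have hle : w x * ∫ t in Set.Ioi x, gaussianPDFReal 0 1 t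
        ≤ ∫ t in Set.Ioi x, w t * gaussianPDFReal 0 1 t := by
      rw [← integral_const_mul]
      exact setIntegral_mono_on (hφ.const_mul _).integrableOn hint.integrableOn
        measurableSet_Ioi fun t ht =>
          mul_le_mul_of_nonneg_right (hw (le_of_lt ht)) (stdGaussianPDF_pos t).le
    have hm := mul_le_mul_of_nonneg_left (mul_stdGaussianPDF_le_integral_Ioi x) h
    have hl := mul_le_mul_of_nonneg_left hle hpos.le
    rw [eq_neg_of_add_eq_zero_left hsum]
    linarith
  · have hle : ∫ t in Set.Iic x, w t * gaussianPDFReal 0 1 t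
        ≤ w x * ∫ t in Set.Iic x, gaussianPDFReal 0 1 t := by
      rw [← integral_const_mul]
      exact setIntegral_mono_on hint.integrableOn (hφ.const_mul _).integrableOn
        measurableSet_Iic fun t ht =>
          mul_le_mul_of_nonneg_right (hw ht) (stdGaussianPDF_pos t).le
    have hm := mul_le_mul_of_nonpos_left (neg_mul_stdGaussianPDF_le_integral_Iic x) h
    have hl := mul_le_mul_of_nonneg_left hle hpos.le
    linarith

lemma integrable_of_lipschitzWith_of_integrable_id {α : Type*} [MeasurableSpace α]
    {μ : Measure α} [IsFiniteMeasure μ] {F : ℝ → ℝ} (hF : LipschitzWith 1 F) {Y : α → ℝ}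
    (hY : Integrable Y μ) : Integrable (fun a => F (Y a)) μ := by
  refine Integrable.mono' (hY.norm.add (integrable_const |F 0|))
    (hF.continuous.comp_aestronglyMeasurable hY.1) (.of_forall fun a => ?_)
  have h := hF.dist_le_mul (Y a) 0
  simp only [Real.dist_eq, NNReal.coe_one, one_mul, sub_zero] at h
  have h2 := abs_sub_abs_le_abs_sub (F (Y a)) (F 0)
  simp only [Real.norm_eq_abs, Pi.add_apply]
  linarith

/-- Stein's equation `f' - x f = F - E[F(Z)]` for a `1`-Lipschitz `F` has a solution `f` bounded by
`1` whose derivative is `2`-Lipschitz. -/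
lemma exists_stein_solution {F : ℝ → ℝ} (hF : LipschitzWith 1 F) :
    ∃ f f' : ℝ → ℝ, (∀ x, HasDerivAt f (f' x) x) ∧
      (∀ x, f' x - x * f x = F x - ∫ t, F t ∂(gaussianReal 0 1)) ∧
      (∀ x, |f x| ≤ 1) ∧ LipschitzWith 2 f' := by
  set c := ∫ t, F t ∂(gaussianReal 0 1) with hc
  set φ := gaussianPDFReal 0 1 with hφ
  have hid : Integrable (fun t : ℝ => t) (gaussianReal 0 1) :=
    (memLp_id_gaussianReal (μ := 0) (v := 1) 1).integrable (by simp)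
  have hFi : Integrable F (gaussianReal 0 1) :=
    integrable_of_lipschitzWith_of_integrable_id hF hid
  have hwi : Integrable (fun t => F t - c) (gaussianReal 0 1) := hFi.sub (integrable_const c)
  have hw0 : ∫ t, F t - c ∂(gaussianReal 0 1) = 0 := by
    rw [integral_sub hFi (integrable_const c)]
    simp [hc]
  have hwφ : Integrable (fun t => (F t - c) * φ t) := integrable_mul_stdGaussianPDF_iff.2 hwi
  have hidφ : Integrable (fun t => t * φ t) := integrable_mul_stdGaussianPDF_iff.2 hid
  have hcont : Continuous (fun t => (F t - c) * φ t) :=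
    (hF.continuous.sub continuous_const).mul continuous_stdGaussianPDF
  set A : ℝ → ℝ := fun x => ∫ t in Set.Iic x, (F t - c) * φ t with hA
  have hAd : ∀ x, HasDerivAt A ((F x - c) * φ x) x := by
    intro x
    have h : A = fun x => A 0 + ∫ t in (0 : ℝ)..x, (F t - c) * φ t := by
      funext y
      rw [← intervalIntegral.integral_Iic_sub_Iic hwφ.integrableOn hwφ.integrableOn]
      ring
    rw [h]
    exact (hcont.integral_hasStrictDerivAt 0 x).hasDerivAt.const_add _
  have hpos : ∀ x, 0 < φ x := stdGaussianPDF_pos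
  set f : ℝ → ℝ := fun x => A x / φ x with hf
  set f' : ℝ → ℝ := fun x => x * f x + (F x - c) with hf'
  have hfd : ∀ x, HasDerivAt f (f' x) x := by
    intro x
    refine ((hAd x).div (hasDerivAt_stdGaussianPDF x) (hpos x).ne').congr_deriv ?_
    have := (hpos x).ne'
    simp only [hf', hf, ← hφ]
    field_simp
    ring
  have habs : ∀ x, |f x + x * f' x| ≤ 1 := by
    intro x
    have hlip : ∀ s t : ℝ, s ≤ t → |F t - F s| ≤ t - s := by
      intro s t hst
      have h := hF.dist_le_mul t s
      simpa [Real.dist_eq, abs_of_nonneg (sub_nonneg.2 hst)] using h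
    have hm1 : Monotone fun t => t + (F t - c) := fun s t hst => by
      have := neg_le_of_abs_le (hlip s t hst)
      simp only
      linarith
    have hm2 : Monotone fun t => t - (F t - c) := fun s t hst => by
      have := le_of_abs_le (hlip s t hst)
      simp only
      linarith
    have hid0 : ∫ t : ℝ, t ∂(gaussianReal 0 1) = 0 := integral_id_gaussianReal
    have h1 := stein_nonpos_of_monotone hm1 (integrable_mul_stdGaussianPDF_iff.2 (hid.add hwi))
      (by rw [integral_mul_stdGaussianPDF, integral_add hid hwi, hid0, hw0, add_zero]) x
    have h2 := stein_nonpos_of_monotone hm2 (integrable_mul_stdGaussianPDF_iff.2 (hid.sub hwi))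
      (by rw [integral_mul_stdGaussianPDF, integral_sub hid hwi, hid0, hw0, sub_zero]) x
    have hI := integral_Iic_id_mul_stdGaussianPDF x
    have hAf : A x = f x * φ x := by simp only [hf]; rw [div_mul_cancel₀ _ (hpos x).ne']
    have hadd : ∫ t in Set.Iic x, (t + (F t - c)) * φ t = -φ x + f x * φ x := by
      rw [← hI, ← hAf, ← integral_add hidφ.integrableOn hwφ.integrableOn]
      simp only [add_mul]
    have hsub : ∫ t in Set.Iic x, (t - (F t - c)) * φ t = -φ x - f x * φ x := by
      rw [← hI, ← hAf, ← integral_sub hidφ.integrableOn hwφ.integrableOn]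
      exact integral_congr_ae (.of_forall fun t => sub_mul t _ _)
    rw [← hφ, hadd] at h1
    rw [← hφ, hsub] at h2
    have hp := hpos x
    have e1 : (f x + x * f' x - 1) * φ x ≤ 0 := by
      simp only [hf']
      linarith
    have e2 : (-(f x + x * f' x) - 1) * φ x ≤ 0 := by
      simp only [hf']
      linarith
    rw [abs_le]
    constructor
    · have := nonpos_of_mul_nonpos_left e2 hp
      linarith
    · have := nonpos_of_mul_nonpos_left e1 hp
      linarith
  have hxf : LipschitzWith 1 fun x => x * f x := by
    refine lipschitzWith_of_nnnorm_deriv_le (fun x => ?_) fun x => ?_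
    · exact ((hasDerivAt_id x).mul (hfd x)).differentiableAt
    · have h : deriv (fun x => x * f x) x = f x + x * f' x := by
        exact (((hasDerivAt_id x).mul (hfd x)).congr_deriv (by simp)).deriv
      rw [h, ← NNReal.coe_le_coe]
      simpa using habs x
  have hfc : Continuous f := continuous_iff_continuousAt.2 fun x => (hfd x).continuousAt
  refine ⟨f, f', hfd, fun x => by simp only [hf']; ring, ?_, ?_⟩
  · have hne : ∀ x ∈ ({0}ᶜ : Set ℝ), |f x| ≤ 1 := by
      intro x hx
      have h := hxf.dist_le_mul x 0
      simp only [Real.dist_eq, zero_mul, sub_zero, NNReal.coe_one, one_mul, abs_mul] at h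
      exact le_of_mul_le_mul_left (by simpa using h) (abs_pos.2 hx)
    have hcl : IsClosed {x | |f x| ≤ 1} := isClosed_le hfc.abs continuous_const
    intro x
    exact (hcl.closure_subset_iff.2 hne) ((dense_compl_singleton (0 : ℝ)) x)
  · have h := hxf.add (hF.sub (LipschitzWith.const c))
    have h2 : (1 + (1 + 0) : ℝ≥0) = 2 := by norm_num
    rwa [h2] at h

lemma sub_slope_le_of_lipschitzWith_deriv {f f' : ℝ → ℝ} (hf : ∀ x, HasDerivAt f (f' x) x)
    (hf' : LipschitzWith 2 f') (x : ℝ) {δ : ℝ} (hδ : 0 ≤ δ) :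
    δ * f' x - (f (x + δ) - f x) ≤ δ ^ 2 := by
  have hd : ∀ s, HasDerivAt (fun s => s * f' x - f (x + s) - s ^ 2)
      (f' x - f' (x + s) - 2 * s) s := by
    intro s
    have h1 := ((hasDerivAt_id s).mul_const (f' x)).sub
      ((hf (x + s)).comp s ((hasDerivAt_id s).const_add x))
    have h2 := h1.sub ((hasDerivAt_id s).pow 2)
    exact h2.congr_deriv (by simp)
  have hanti : AntitoneOn (fun s => s * f' x - f (x + s) - s ^ 2) (Set.Ici 0) := by
    refine antitoneOn_of_deriv_nonpos (convex_Ici 0)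
      (fun s _ => (hd s).continuousAt.continuousWithinAt)
      (fun s _ => (hd s).differentiableAt.differentiableWithinAt) fun s hs => ?_
    rw [interior_Ici] at hs
    rw [(hd s).deriv]
    have h := hf'.dist_le_mul x (x + s)
    simp only [Real.dist_eq, sub_add_cancel_left, abs_neg, abs_of_pos (Set.mem_Ioi.1 hs)] at h
    have := le_of_abs_le h
    norm_num at this
    linarith
  have h := hanti Set.self_mem_Ici (Set.mem_Ici.2 hδ) hδ
  simp at h
  linarith

lemma integrable_natCast_poissonMeasure (r : ℝ≥0) :
    Integrable (fun n : ℕ => (n : ℝ)) (poissonMeasure r) := by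
  rw [integrable_poissonMeasure_iff, ← summable_nat_add_iff 1]
  refine ((hasSum_one_poissonMeasure r).summable.mul_left (r : ℝ)).congr fun n => ?_
  rw [Real.norm_natCast, Nat.factorial_succ]
  have := Nat.factorial_pos n
  push_cast
  field_simp
  ring

/-- The Chen–Stein identity for the Poisson law. -/
lemma integral_natCast_mul_poissonMeasure (r : ℝ≥0) {g : ℕ → ℝ} {C : ℝ} (hg : ∀ n, |g n| ≤ C) :
    ∫ n : ℕ, (n : ℝ) * g n ∂(poissonMeasure r) = r * ∫ n, g (n + 1) ∂(poissonMeasure r) := by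
  have hi : Integrable (fun n : ℕ => (n : ℝ) * g n) (poissonMeasure r) :=
    (integrable_natCast_poissonMeasure r).mul_bdd (c := C)
      Measurable.of_discrete.aestronglyMeasurable (.of_forall hg)
  have h := (hasSum_integral_poissonMeasure hi).summable.tsum_eq_zero_add
  rw [integral_poissonMeasure, integral_poissonMeasure, h, ← tsum_mul_left]
  simp only [Nat.cast_zero, zero_mul, smul_zero, zero_add]
  refine tsum_congr fun n => ?_
  rw [Nat.factorial_succ, smul_eq_mul, smul_eq_mul]
  have := Nat.factorial_pos n
  push_cast
  field_simp
  ring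

set_option linter.deprecated false in
lemma poissonPMF_toMeasure (r : ℝ≥0) : (poissonPMF r).toMeasure = poissonMeasure r := by
  refine Measure.ext_of_singleton fun n => ?_
  rw [PMF.toMeasure_apply_singleton _ _ (measurableSet_singleton n), poissonMeasure_singleton]
  exact (poissonPMFReal_ofReal_eq_poissonPMF r n).symm

/-- Gaussian approximation of the normalized Poisson law, tested on a `1`-Lipschitz function. -/
lemma integral_poissonMeasure_sub_integral_gaussianReal_le {r : ℝ≥0} (hr : 0 < r) {F : ℝ → ℝ}
    (hF : LipschitzWith 1 F) :
    (∫ n : ℕ, F (((n : ℝ) - r) / Real.sqrt r) ∂(poissonMeasure r))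
      - ∫ t, F t ∂(gaussianReal 0 1) ≤ 1 / Real.sqrt r := by
  obtain ⟨f, f', hfd, hstein, hbound, hlip⟩ := exists_stein_solution hF
  set c := ∫ t, F t ∂(gaussianReal 0 1)
  have hr' : (0 : ℝ) < r := hr
  set s := Real.sqrt r with hs
  have hs0 : 0 < s := Real.sqrt_pos.2 hr'
  have hss : (r : ℝ) = s ^ 2 := (Real.sq_sqrt hr'.le).symm
  have hni := integrable_natCast_poissonMeasure r
  set g : ℕ → ℝ := fun n => f (((n : ℝ) - r) / s) with hg
  have hgb : ∀ n, |g n| ≤ 1 := fun n => hbound _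
  have hgi : Integrable (fun n => g (n + 1)) (poissonMeasure r) :=
    Integrable.of_bound Measurable.of_discrete.aestronglyMeasurable 1
      (.of_forall fun n => hgb (n + 1))
  have hngi : Integrable (fun n : ℕ => (n : ℝ) * g n) (poissonMeasure r) :=
    hni.mul_bdd (c := 1) Measurable.of_discrete.aestronglyMeasurable (.of_forall hgb)
  have hFi : Integrable (fun n : ℕ => F (((n : ℝ) - r) / s)) (poissonMeasure r) :=
    integrable_of_lipschitzWith_of_integrable_id hF
      ((hni.sub (integrable_const (r : ℝ))).div_const s)
  have hpt : ∀ n : ℕ, F (((n : ℝ) - r) / s)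
      ≤ (c + 1 / s) + (1 / s) * (r * g (n + 1) - n * g n) := by
    intro n
    set x := ((n : ℝ) - r) / s with hx
    have hg1 : g (n + 1) = f (x + 1 / s) := by
      simp only [hg, hx]
      congr 1
      push_cast
      ring
    have h1 := sub_slope_le_of_lipschitzWith_deriv hfd hlip x (one_div_pos.2 hs0).le
    have h2 := hstein x
    have hn : (n : ℝ) = s ^ 2 + s * x := by
      rw [hx, mul_div_cancel₀ _ hs0.ne', ← hss]
      ring
    have h3 := mul_le_mul_of_nonneg_left h1 hs0.le
    have e1 : s * (1 / s * f' x - (f (x + 1 / s) - f x)) =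
        f' x - s * (f (x + 1 / s) - f x) := by
      field_simp
    have e2 : s * (1 / s) ^ 2 = 1 / s := by field_simp
    have e3 : 1 / s * (r * g (n + 1) - n * g n) = s * (f (x + 1 / s) - f x) - x * f x := by
      rw [hg1, hn, hss, show g n = f x from rfl]
      field_simp
      ring
    rw [e1, e2] at h3
    rw [e3]
    linarith
  have hint := integral_mono hFi
    ((integrable_const (c + 1 / s)).add (((hgi.const_mul (r : ℝ)).sub hngi).const_mul (1 / s))) hpt
  have hz : ∫ n : ℕ, ((r : ℝ) * g (n + 1) - n * g n) ∂(poissonMeasure r) = 0 := by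
    rw [integral_sub (hgi.const_mul (r : ℝ)) hngi, integral_const_mul,
      integral_natCast_mul_poissonMeasure r hgb, sub_self]
  have heq : ∫ n : ℕ, ((c + 1 / s) + (1 / s) * (r * g (n + 1) - n * g n)) ∂(poissonMeasure r)
      = c + 1 / s := by
    have hi : Integrable (fun n : ℕ => (1 / s) * (r * g (n + 1) - n * g n)) (poissonMeasure r) :=
      ((hgi.const_mul (r : ℝ)).sub hngi).const_mul (1 / s)
    rw [integral_add (integrable_const _) hi, integral_const_mul, hz]
    simp
  have := hint.trans_eq heq
  linarith

theorem poisson_normal_approximation_wasserstein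
    (lam : ℝ) (hlam : 0 < lam)
    {Ω : Type} [MeasurableSpace Ω] (P : Measure Ω) [IsProbabilityMeasure P]
    (X : Ω → ℕ) (hX : Measure.map X P = (poissonPMF lam.toNNReal).toMeasure)
    {Ω' : Type} [MeasurableSpace Ω'] (P' : Measure Ω') [IsProbabilityMeasure P']
    (Z : Ω' → ℝ) (hZ : Measure.map Z P' = gaussianReal 0 1) :
    sSup { r : ℝ | ∃ F : ℝ → ℝ, LipschitzWith 1 F ∧
        r = (∫ ω, F (((X ω : ℝ) - lam) / Real.sqrt lam) ∂P) - ∫ ω, F (Z ω) ∂P' }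
      ≤ 1 / Real.sqrt lam := by
  refine Real.sSup_le ?_ (by positivity)
  rintro _ ⟨F, hF, rfl⟩
  have hr : 0 < lam.toNNReal := Real.toNNReal_pos.2 hlam
  have hcoe : (lam.toNNReal : ℝ) = lam := Real.coe_toNNReal lam hlam.le
  rw [poissonPMF_toMeasure] at hX
  have hXm : AEMeasurable X P := AEMeasurable.of_map_ne_zero (hX ▸ IsProbabilityMeasure.ne_zero _)
  have hZm : AEMeasurable Z P' := AEMeasurable.of_map_ne_zero (hZ ▸ IsProbabilityMeasure.ne_zero _)
  have h1 : ∫ ω, F (((X ω : ℝ) - lam) / Real.sqrt lam) ∂P =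
      ∫ n : ℕ, F (((n : ℝ) - lam) / Real.sqrt lam) ∂(poissonMeasure lam.toNNReal) := by
    rw [← hX, integral_map hXm Measurable.of_discrete.aestronglyMeasurable]
  have h2 : ∫ ω, F (Z ω) ∂P' = ∫ t, F t ∂(gaussianReal 0 1) := by
    rw [← hZ, integral_map hZm hF.continuous.aestronglyMeasurable]
  have h := integral_poissonMeasure_sub_integral_gaussianReal_le hr hF
  rw [hcoe] at h
  rw [h1, h2]
  exact h
end
end

section
/- Let 0 < β < 1/2, (e_n)_{n≥1} an orthonormal basis of L²([0,1]), h_n^{1−β} = I^{1−β}_{1^-}(e_n), and for m ≥ 1 let p_{F_m} be the orthogonal projection of L²([0,1]) onto span{√m·𝟙_{[j/m,(j+1)/m)} : 0 ≤ j ≤ m−1}. Then Σ_{n≥1} ‖(Id − p_{F_m}) h_n^{1−β}‖²_{L²([0,1])} ≤ m^{2β−1}/((1−2β)·Γ(1−β)²). Consequently, the trace norm of the difference between S_β and the covariance of the projected basis satisfies ‖Σ_{n,k}(⟨p_{F_m}h_n^{1−β}, p_{F_m}h_k^{1−β}⟩ − ⟨h_n^{1−β}, h_k^{1−β}⟩)x_n⊗x_k‖_{𝒮₁}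 ≤ m^{2β−1}/((1−2β)Γ(1−β)²). -/
/- Statement 15: For 0 < β < 1/2 and p_{F_m} the orthogonal projection of L²([0,1])
onto span{√m·𝟙_{[j/m,(j+1)/m)}}, one has
Σ_n ‖(Id − p_{F_m})h_n^{1−β}‖²_{L²} ≤ m^{2β−1}/((1−2β)Γ(1−β)²); consequently the trace
norm of Σ_{n,k}(⟨p_{F_m}h_n^{1−β}, p_{F_m}h_k^{1−β}⟩ − ⟨h_n^{1−β}, h_k^{1−β}⟩)x_n⊗x_k
is bounded by the same quantity. -/

open MeasureTheory ProbabilityTheory Filter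
open scoped ENNReal NNReal RealInnerProductSpace Classical

noncomputable section

lemma enorm_sq_eq_ofReal_norm_sq {H : Type*} [NormedAddCommGroup H] (x : H) :
    ‖x‖ₑ ^ 2 = ENNReal.ofReal (‖x‖ ^ 2) := by
  rw [← ofReal_norm, ENNReal.ofReal_pow (norm_nonneg x)]

section HilbertSchmidt

variable {ι κ H G : Type*} [NormedAddCommGroup H] [InnerProductSpace ℝ H]
  [NormedAddCommGroup G] [InnerProductSpace ℝ G]

lemma HilbertBasis.tsum_enorm_inner_sq (b : HilbertBasis ι ℝ H) (x : H) :
    ∑' i, ‖⟪b i, x⟫‖ₑ ^ 2 = ‖x‖ₑ ^ 2 := by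
  have key : HasSum (fun i => ‖⟪b i, x⟫‖ ^ 2) (‖x‖ ^ 2) := by
    have h := b.hasSum_inner_mul_inner x x
    rw [real_inner_self_eq_norm_sq] at h
    refine h.congr_fun fun i => ?_
    rw [real_inner_comm, Real.norm_eq_abs, sq_abs, sq]
  simp_rw [enorm_sq_eq_ofReal_norm_sq]
  rw [← key.tsum_eq, ENNReal.ofReal_tsum_of_nonneg (fun _ => by positivity) key.summable]

variable [CompleteSpace H] [CompleteSpace G]

lemma tsum_enorm_sq_eq_adjoint (W : H →L[ℝ] G) (e : HilbertBasis ι ℝ H)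
    (u : HilbertBasis κ ℝ G) :
    ∑' n, ‖W (e n)‖ₑ ^ 2 = ∑' i, ‖ContinuousLinearMap.adjoint W (u i)‖ₑ ^ 2 := by
  simp_rw [← u.tsum_enorm_inner_sq, ← e.tsum_enorm_inner_sq]
  rw [ENNReal.tsum_comm]
  simp_rw [ContinuousLinearMap.adjoint_inner_right, real_inner_comm]

lemma tsum_enorm_inner_map_map_le (W : H →L[ℝ] G) (u : HilbertBasis κ ℝ G)
    (b e f : HilbertBasis ι ℝ H) :
    ∑' n, ‖⟪W (e n), W (f n)⟫‖ₑ ≤ ∑' n, ‖W (b n)‖ₑ ^ 2 := by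
  have amgm (x y : G) : 2 * ‖⟪x, y⟫‖ₑ ≤ ‖x‖ₑ ^ 2 + ‖y‖ₑ ^ 2 := by
    simp_rw [enorm_sq_eq_ofReal_norm_sq, ← ofReal_norm]
    rw [← ENNReal.ofReal_add (by positivity) (by positivity), ← ENNReal.ofReal_ofNat,
      ← ENNReal.ofReal_mul (by norm_num)]
    refine ENNReal.ofReal_le_ofReal ?_
    nlinarith [norm_inner_le_norm (𝕜 := ℝ) x y, sq_nonneg (‖x‖ - ‖y‖)]
  have h : 2 * ∑' n, ‖⟪W (e n), W (f n)⟫‖ₑ ≤ 2 * ∑' n, ‖W (b n)‖ₑ ^ 2 := by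
    calc 2 * ∑' n, ‖⟪W (e n), W (f n)⟫‖ₑ
        ≤ ∑' n, (‖W (e n)‖ₑ ^ 2 + ‖W (f n)‖ₑ ^ 2) := by
          rw [← ENNReal.tsum_mul_left]
          exact ENNReal.tsum_le_tsum fun n => amgm _ _
      _ = 2 * ∑' n, ‖W (b n)‖ₑ ^ 2 := by
          rw [ENNReal.tsum_add]
          simp_rw [tsum_enorm_sq_eq_adjoint W _ u]
          rw [two_mul]
  exact (ENNReal.mul_le_mul_iff_right (by norm_num) (by norm_num)).1 h

end HilbertSchmidt

/-- The canonical basis of `l2` as a Hilbert basis. -/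
def l2Basis : HilbertBasis ℕ ℝ l2 := HilbertBasis.ofRepr (LinearIsometryEquiv.refl ℝ l2)

lemma l2Basis_apply (n : ℕ) : l2Basis n = xb n := by
  rw [← l2Basis.repr_symm_single, xb]
  rfl

lemma inner_xb_left (n : ℕ) (a : l2) : ⟪xb n, a⟫ = a n := by
  simp [xb, lp.inner_single_left]

section Synthesis

variable {G : Type*} [NormedAddCommGroup G] [InnerProductSpace ℝ G] [CompleteSpace G]

lemma exists_clm_map_xb_eq (w : ℕ → G) (hw : Summable fun n => ‖w n‖ ^ 2) :
    ∃ W : l2 →L[ℝ] G, ∀ n, W (xb n) = w n := by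
  have bound (u : G) (n : ℕ) : ‖⟪w n, u⟫‖ ^ 2 ≤ ‖w n‖ ^ 2 * ‖u‖ ^ 2 := by
    rw [← mul_pow]
    exact pow_le_pow_left₀ (norm_nonneg _) (norm_inner_le_norm _ _) 2
  have summ (u : G) : Summable fun n => ‖⟪w n, u⟫‖ ^ 2 :=
    (hw.mul_right (‖u‖ ^ 2)).of_nonneg_of_le (fun _ => by positivity) (bound u)
  have mem (u : G) : Memℓp (E := fun _ : ℕ => ℝ) (fun n => ⟪w n, u⟫) 2 := by
    rw [memℓp_gen_iff (by norm_num)]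
    simpa using summ u
  let A : G →ₗ[ℝ] l2 :=
    { toFun := fun u => ⟨fun n => ⟪w n, u⟫, mem u⟩
      map_add' := fun u v => by ext n; exact inner_add_right _ _ _
      map_smul' := fun c u => by ext n; exact inner_smul_right _ _ _ }
  let B : G →L[ℝ] l2 := A.mkContinuous (Real.sqrt (∑' n, ‖w n‖ ^ 2)) fun u => by
    refine lp.norm_le_of_tsum_le (by norm_num) (by positivity) ?_
    have : (∑' n, ‖⟪w n, u⟫‖ ^ 2) ≤ (Real.sqrt (∑' n, ‖w n‖ ^ 2) * ‖u‖) ^ 2 := by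
      rw [mul_pow, Real.sq_sqrt (tsum_nonneg fun _ => by positivity), ← tsum_mul_right]
      exact (summ u).tsum_le_tsum (bound u) (hw.mul_right _)
    simpa [A] using this
  refine ⟨ContinuousLinearMap.adjoint B, fun n => ext_inner_right ℝ fun u => ?_⟩
  rw [ContinuousLinearMap.adjoint_inner_left, inner_xb_left]
  rfl

lemma inner_eq_of_inner_xb_eq (T : l2 →L[ℝ] l2) (W : l2 →L[ℝ] G)
    (hT : ∀ n k, ⟪T (xb k), xb n⟫ = -⟪W (xb n), W (xb k)⟫) (a b : l2) :
    ⟪T a, b⟫ = -⟪W a, W b⟫ := by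
  have hTW : T = -(ContinuousLinearMap.adjoint W ∘L W) := by
    refine lp.ext_continuousLinearMap (by norm_num) fun k => ?_
    ext n
    have := hT n k
    rw [real_inner_comm (xb n), inner_xb_left] at this
    have h2 : ((ContinuousLinearMap.adjoint W) (W (xb k)) : l2) n = ⟪W (xb n), W (xb k)⟫ := by
      rw [← inner_xb_left, ContinuousLinearMap.adjoint_inner_right]
    change (T (xb k)) n = -((ContinuousLinearMap.adjoint W) (W (xb k)) : l2) n
    rw [h2, this]
  rw [hTW]
  simp [ContinuousLinearMap.adjoint_inner_left]

lemma traceNormE_le_of_gram (u : HilbertBasis ℕ ℝ G) (w : ℕ → G) {C : ℝ}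
    (hC : ∑' n, ‖w n‖ₑ ^ 2 ≤ ENNReal.ofReal C)
    (hw : Summable fun n => ‖w n‖ ^ 2) (T : l2 →L[ℝ] l2)
    (hT : ∀ n k, ⟪T (xb k), xb n⟫ = -⟪w n, w k⟫) :
    traceNormE T ≤ ENNReal.ofReal C := by
  obtain ⟨W, hW⟩ := exists_clm_map_xb_eq w hw
  simp_rw [← hW] at hT hC
  simp_rw [← l2Basis_apply] at hC
  refine iSup₂_le fun e f => ?_
  refine le_trans ?_ ((tsum_enorm_inner_map_map_le W u l2Basis e f).trans hC)
  refine ENNReal.tsum_le_tsum fun n => ?_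
  rw [inner_eq_of_inner_xb_eq T W hT, nnnorm_neg]
  rfl

end Synthesis

section Kernel

/-- The power kernel `t ↦ (t - a) ^ (-β)` truncated to `(b, 1]`. -/
def truncKernel (β a b : ℝ) : ℝ → ℝ := (Set.Ioc b 1).indicator fun t => (t - a) ^ (-β)

lemma measurable_truncKernel (β a b : ℝ) : Measurable (truncKernel β a b) :=
  Measurable.indicator (by fun_prop) measurableSet_Ioc

lemma restrict_μ01_Ioc {b : ℝ} (hb : 0 ≤ b) :
    μ01.restrict (Set.Ioc b 1) = volume.restrict (Set.Ioc b 1) := by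
  rw [Measure.restrict_restrict measurableSet_Ioc, Set.inter_eq_left.2]
  exact Set.Ioc_subset_Icc_self.trans (Set.Icc_subset_Icc_left hb)

variable {β a b : ℝ}

lemma truncKernel_sq (hab : a ≤ b) :
    (fun t => truncKernel β a b t ^ 2) =
      (Set.Ioc b 1).indicator fun t => (t - a) ^ (-(2 * β)) := by
  funext t
  by_cases ht : t ∈ Set.Ioc b 1
  · rw [truncKernel, Set.indicator_of_mem ht, Set.indicator_of_mem ht,
      ← Real.rpow_mul_natCast (by linarith [ht.1])]
    congr 1
    push_cast
    ring
  · simp [truncKernel, Set.indicator_of_notMem ht]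

lemma integrable_truncKernel_sq (hβ : β < 1 / 2) (ha : 0 ≤ a) (hab : a ≤ b) (hb : b ≤ 1) :
    Integrable (fun t => truncKernel β a b t ^ 2) μ01 := by
  rw [truncKernel_sq hab, integrable_indicator_iff measurableSet_Ioc, IntegrableOn,
    restrict_μ01_Ioc (ha.trans hab)]
  have h := (intervalIntegral.intervalIntegrable_rpow' (a := b - a) (b := 1 - a)
    (r := -(2 * β)) (by linarith)).comp_sub_right a
  simp only [sub_add_cancel] at h
  exact (intervalIntegrable_iff_integrableOn_Ioc_of_le hb).1 h

lemma integral_truncKernel_sq (hβ : β < 1 / 2) (ha : 0 ≤ a) (hab : a ≤ b) (hb : b ≤ 1) :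
    ∫ t, truncKernel β a b t ^ 2 ∂μ01 =
      ((1 - a) ^ (1 - 2 * β) - (b - a) ^ (1 - 2 * β)) / (1 - 2 * β) := by
  rw [truncKernel_sq hab, integral_indicator measurableSet_Ioc, restrict_μ01_Ioc (ha.trans hab),
    ← intervalIntegral.integral_of_le hb,
    intervalIntegral.integral_comp_sub_right (fun t => t ^ (-(2 * β))),
    integral_rpow (Or.inl (by linarith)), show -(2 * β) + 1 = 1 - 2 * β by ring]

lemma memLp_truncKernel (hβ : β < 1 / 2) (ha : 0 ≤ a) (hab : a ≤ b) (hb : b ≤ 1) :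
    MemLp (truncKernel β a b) 2 μ01 :=
  (memLp_two_iff_integrable_sq (measurable_truncKernel β a b).aestronglyMeasurable).2
    (integrable_truncKernel_sq hβ ha hab hb)

lemma truncKernel_sub_sq_le {x : ℝ} (hβ : 0 ≤ β) (hax : a ≤ x) (hxb : x ≤ b) (t : ℝ) :
    (truncKernel β x x t - truncKernel β a b t) ^ 2 ≤
      truncKernel β x x t ^ 2 - truncKernel β a b t ^ 2 := by
  by_cases ht : t ∈ Set.Ioc b 1
  · have hx : t ∈ Set.Ioc x 1 := ⟨hxb.trans_lt ht.1, ht.2⟩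
    simp only [truncKernel, Set.indicator_of_mem ht, Set.indicator_of_mem hx]
    have h0 : 0 ≤ (t - a) ^ (-β) := Real.rpow_nonneg (by linarith [hx.1]) _
    have h1 : (t - a) ^ (-β) ≤ (t - x) ^ (-β) :=
      Real.rpow_le_rpow_of_nonpos (by linarith [hx.1]) (by linarith) (by linarith)
    nlinarith
  · simp [truncKernel, Set.indicator_of_notMem ht]

lemma integral_truncKernel_sub_sq_le {x : ℝ} (hβ0 : 0 ≤ β) (hβ : β < 1 / 2) (ha : 0 ≤ a)
    (hax : a ≤ x) (hxb : x ≤ b) (hb : b ≤ 1) :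
    ∫ t, (truncKernel β x x t - truncKernel β a b t) ^ 2 ∂μ01 ≤
      (b - a) ^ (1 - 2 * β) / (1 - 2 * β) := by
  have hx := integrable_truncKernel_sq hβ (ha.trans hax) le_rfl (hxb.trans hb)
  have hab := integrable_truncKernel_sq hβ ha (hax.trans hxb) hb
  calc ∫ t, (truncKernel β x x t - truncKernel β a b t) ^ 2 ∂μ01
      ≤ ∫ t, (truncKernel β x x t ^ 2 - truncKernel β a b t ^ 2) ∂μ01 :=
        integral_mono_of_nonneg (ae_of_all _ fun t => sq_nonneg _) (hx.sub hab)
          (ae_of_all _ (truncKernel_sub_sq_le hβ0 hax hxb))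
    _ ≤ (b - a) ^ (1 - 2 * β) / (1 - 2 * β) := by
        rw [integral_sub hx hab, integral_truncKernel_sq hβ (ha.trans hax) le_rfl (hxb.trans hb),
          integral_truncKernel_sq hβ ha (hax.trans hxb) hb, sub_self,
          Real.zero_rpow (by linarith), ← sub_div]
        have : (1 - x) ^ (1 - 2 * β) ≤ (1 - a) ^ (1 - 2 * β) :=
          Real.rpow_le_rpow (by linarith) (by linarith) (by linarith)
        gcongr
        · linarith
        · linarith

lemma norm_sq_toLp {f : ℝ → ℝ} (hf : MemLp f 2 μ01) :
    ‖hf.toLp f‖ ^ 2 = ∫ t, f t ^ 2 ∂μ01 := by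
  rw [← real_inner_self_eq_norm_sq, MeasureTheory.L2.inner_def]
  refine integral_congr_ae ?_
  filter_upwards [hf.coeFn_toLp] with t ht
  rw [ht, real_inner_self_eq_norm_sq, Real.norm_eq_abs, sq_abs]

lemma Ifrac_eq_inner {x : ℝ} (hx : 0 ≤ x) (hK : MemLp (truncKernel β x x) 2 μ01) (f : L2) :
    Ifrac β f x = (1 / Real.Gamma (1 - β)) * ⟪f, hK.toLp _⟫ := by
  rw [Ifrac, MeasureTheory.L2.inner_def, ← restrict_μ01_Ioc hx,
    ← integral_indicator measurableSet_Ioc]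
  congr 1
  refine integral_congr_ae ?_
  filter_upwards [hK.coeFn_toLp] with t ht
  rw [ht]
  by_cases h : t ∈ Set.Ioc x 1
  · simp [truncKernel, Set.indicator_of_mem h, mul_comm]
  · simp [truncKernel, Set.indicator_of_notMem h]

end Kernel

section Projection

lemma Orthonormal.norm_sub_proj_le {ι H : Type*} [Fintype ι] [NormedAddCommGroup H]
    [InnerProductSpace ℝ H] {v : ι → H} (hv : Orthonormal ℝ v) (f : H) (c : ι → ℝ) :
    ‖f - ∑ j, ⟪v j, f⟫ • v j‖ ≤ ‖f - ∑ j, c j • v j‖ := by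
  set q := f - ∑ j, ⟪v j, f⟫ • v j with hq
  have horth : ⟪q, ∑ j, (⟪v j, f⟫ - c j) • v j⟫ = 0 := by
    rw [inner_sum]
    refine Finset.sum_eq_zero fun j _ => ?_
    rw [real_inner_smul_right, real_inner_comm (v j) q, hq, inner_sub_right, hv.inner_right_fintype, sub_self,
      mul_zero]
  have hsum : f - ∑ j, c j • v j = q + ∑ j, (⟪v j, f⟫ - c j) • v j := by
    simp only [hq, sub_smul, Finset.sum_sub_distrib]
    abel
  have := norm_add_sq_eq_norm_sq_add_norm_sq_of_inner_eq_zero _ _ horth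
  rw [← hsum] at this
  nlinarith [norm_nonneg q, norm_nonneg (f - ∑ j, c j • v j),
    mul_self_nonneg ‖∑ j, (⟪v j, f⟫ - c j) • v j‖]

lemma Orthonormal.inner_proj_proj_sub {ι H : Type*} [Fintype ι] [NormedAddCommGroup H]
    [InnerProductSpace ℝ H] {v : ι → H} (hv : Orthonormal ℝ v) (f g : H) :
    ⟪∑ j, ⟪v j, f⟫ • v j, ∑ j, ⟪v j, g⟫ • v j⟫ - ⟪f, g⟫ =
      -⟪f - ∑ j, ⟪v j, f⟫ • v j, g - ∑ j, ⟪v j, g⟫ • v j⟫ := by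
  have key (x y : H) : ⟪∑ j, ⟪v j, x⟫ • v j, y⟫ =
      ⟪∑ j, ⟪v j, x⟫ • v j, ∑ j, ⟪v j, y⟫ • v j⟫ := by
    simp_rw [sum_inner, real_inner_smul_left, hv.inner_right_fintype]
  have key' := key g f
  rw [real_inner_comm f, real_inner_comm (∑ j, ⟪v j, f⟫ • v j)] at key'
  rw [inner_sub_left, inner_sub_right, inner_sub_right, key f g, key']
  ring

/-- The cell `[j / m, (j + 1) / m)` of the uniform partition of `[0, 1)`. -/
def cell (m j : ℕ) : Set ℝ := Set.Ico ((j : ℝ) / m) (((j : ℝ) + 1) / m)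

lemma measurableSet_cell (m j : ℕ) : MeasurableSet (cell m j) := measurableSet_Ico

variable {m : ℕ}

lemma cell_subset (hm : 1 ≤ m) (j : Fin m) : cell m j ⊆ Set.Icc 0 1 := by
  have hm' : (0 : ℝ) < m := by exact_mod_cast hm
  have hj : ((j : ℕ) : ℝ) + 1 ≤ m := by exact_mod_cast j.2
  refine fun s hs => ⟨le_trans (by positivity) hs.1, hs.2.le.trans ?_⟩
  rwa [div_le_one hm']

lemma mem_cell_iff (hm : 1 ≤ m) {s : ℝ} (hs : 0 ≤ s) (j : ℕ) :
    s ∈ cell m j ↔ ⌊s * m⌋₊ = j := by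
  have hm' : (0 : ℝ) < m := by exact_mod_cast hm
  rw [Nat.floor_eq_iff (by positivity), cell, Set.mem_Ico, div_le_iff₀ hm', lt_div_iff₀ hm']

lemma volume_real_cell (hm : 1 ≤ m) (j : Fin m) : μ01.real (cell m j) = 1 / m := by
  have hm' : (0 : ℝ) < m := by exact_mod_cast hm
  rw [measureReal_restrict_apply (measurableSet_cell m j), Set.inter_eq_left.2 (cell_subset hm j), cell,
    Real.volume_real_Ico_of_le (by gcongr; linarith)]
  ring

lemma orthonormal_of_ae_eq_cell (hm : 1 ≤ m) {ind : Fin m → L2}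
    (hind : ∀ j, ind j =ᵐ[μ01] (cell m j).indicator fun _ => Real.sqrt m) :
    Orthonormal ℝ ind := by
  have hm' : (0 : ℝ) < m := by exact_mod_cast hm
  rw [orthonormal_iff_ite]
  intro i j
  rw [MeasureTheory.L2.inner_def]
  have hae : (fun s => ⟪ind i s, ind j s⟫) =ᵐ[μ01]
      (cell m j).indicator fun _ => if i = j then (m : ℝ) else 0 := by
    filter_upwards [hind i, hind j, ae_restrict_mem measurableSet_Icc] with s hi hj hs
    rw [hi, hj]
    by_cases hsj : s ∈ cell m j
    · have : s ∈ cell m i ↔ i = j := by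
        rw [mem_cell_iff hm hs.1] at hsj ⊢
        rw [hsj, eq_comm, Fin.ext_iff]
      by_cases hij : i = j <;> simp [this, hsj, hij]
    · simp [hsj]
  rw [integral_congr_ae hae, integral_indicator (measurableSet_cell m j), setIntegral_const,
    volume_real_cell hm]
  split_ifs
  · simp [hm'.ne']
  · simp

end Projection

section StepApproximation

lemma L2_enorm_sq (f : L2) : ‖f‖ₑ ^ 2 = ∫⁻ x, ‖f x‖ₑ ^ 2 ∂μ01 := by
  have h := eLpNorm_nnreal_pow_eq_lintegral (μ := μ01) (f := f) (p := 2) two_ne_zero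
  simpa [Lp.enorm_def] using h

variable {m : ℕ} {ind : Fin m → L2}

lemma ae_sum_smul_eq (hm : 1 ≤ m)
    (hind : ∀ j, ind j =ᵐ[μ01] (cell m j).indicator fun _ => Real.sqrt m) (c : Fin m → ℝ) :
    ∀ᵐ x ∂μ01, ∀ j : Fin m, x ∈ cell m j → (∑ i, c i • ind i : L2) x = c j * Real.sqrt m := by
  have hsmul : ∀ᵐ x ∂μ01, ∀ i, (c i • ind i : L2) x = c i * ind i x :=
    ae_all_iff.2 fun i => Lp.coeFn_smul (c i) (ind i)
  filter_upwards [Lp.coeFn_finsetSum Finset.univ fun i => c i • ind i, hsmul, ae_all_iff.2 hind,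
    ae_restrict_mem measurableSet_Icc] with x hsum hsmul hi hx j hj
  rw [hsum, Finset.sum_apply, Finset.sum_eq_single j]
  · rw [hsmul, hi, Set.indicator_of_mem hj]
  · intro i _ hij
    have : x ∉ cell m i := fun h =>
      hij (Fin.ext (((mem_cell_iff hm hx.1 i).1 h).symm.trans ((mem_cell_iff hm hx.1 j).1 hj)))
    rw [hsmul, hi, Set.indicator_of_notMem this, mul_zero]
  · simp

lemma ae_exists_mem_cell (hm : 1 ≤ m) : ∀ᵐ x ∂μ01, ∃ j : Fin m, x ∈ cell m j := by
  have hm' : (0 : ℝ) < m := by exact_mod_cast hm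
  filter_upwards [ae_restrict_mem measurableSet_Icc, ae_restrict_of_ae (Measure.ae_ne volume 1)]
    with x hx hx1
  have hlt : x * m < m := mul_lt_of_lt_one_left hm' (lt_of_le_of_ne hx.2 hx1)
  exact ⟨⟨⌊x * m⌋₊, (Nat.floor_lt (mul_nonneg hx.1 hm'.le)).2 hlt⟩,
    (mem_cell_iff hm hx.1 _).2 rfl⟩

variable {β : ℝ}

lemma exists_cell_kernel (hβ0 : 0 < β) (hβ : β < 1 / 2) (hm : 1 ≤ m) (j : Fin m) :
    ∃ C : L2, ∀ x ∈ cell m j, ∃ K : L2,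
      (∀ f : L2, Ifrac β f x = (1 / Real.Gamma (1 - β)) * ⟪f, K⟫) ∧
      ‖K - C‖ ^ 2 ≤ (m : ℝ) ^ (2 * β - 1) / (1 - 2 * β) := by
  have hm' : (0 : ℝ) < m := by exact_mod_cast hm
  set a : ℝ := (j : ℝ) / m with ha
  set b : ℝ := ((j : ℝ) + 1) / m with hb
  have ha0 : 0 ≤ a := by positivity
  have hab : a ≤ b := by rw [ha, hb]; gcongr; linarith
  have hb1 : b ≤ 1 := by
    rw [hb, div_le_one hm']
    exact_mod_cast j.2
  have hC := memLp_truncKernel hβ ha0 hab hb1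
  refine ⟨hC.toLp _, fun x hx => ?_⟩
  have hax : a ≤ x := hx.1
  have hxb : x ≤ b := hx.2.le
  have hK := memLp_truncKernel hβ (ha0.trans hax) (le_refl x) (hxb.trans hb1)
  refine ⟨hK.toLp _, Ifrac_eq_inner (ha0.trans hax) hK, ?_⟩
  rw [← MemLp.toLp_sub, norm_sq_toLp]
  refine (integral_truncKernel_sub_sq_le hβ0.le hβ ha0 hax hxb hb1).trans_eq ?_
  have hlen : b - a = (m : ℝ)⁻¹ := by
    rw [ha, hb]
    ring
  rw [hlen, Real.inv_rpow hm'.le, ← Real.rpow_neg hm'.le, neg_sub]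

lemma tsum_enorm_sub_proj_le (hβ0 : 0 < β) (hβ : β < 1 / 2) (hm : 1 ≤ m)
    (e : HilbertBasis ℕ ℝ L2) (h : ℕ → L2) (hh : ∀ n, ∀ᵐ x ∂μ01, h n x = Ifrac β (e n : L2) x)
    (hind : ∀ j, ind j =ᵐ[μ01] (cell m j).indicator fun _ => Real.sqrt m) :
    ∑' n, ‖h n - ∑ j, ⟪ind j, h n⟫ • ind j‖ₑ ^ 2 ≤
      ENNReal.ofReal ((m : ℝ) ^ (2 * β - 1) / ((1 - 2 * β) * Real.Gamma (1 - β) ^ 2)) := by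
  have hm' : (0 : ℝ) < m := by exact_mod_cast hm
  choose C hC using exists_cell_kernel hβ0 hβ hm
  set γ := 1 / Real.Gamma (1 - β) with hγ
  set g : ℕ → L2 := fun n => ∑ j, (γ * ⟪e n, C j⟫ / Real.sqrt m) • ind j with hg
  have hpoint : ∀ᵐ x ∂μ01, ∑' n, ‖(h n - g n : L2) x‖ₑ ^ 2 ≤
      ENNReal.ofReal ((m : ℝ) ^ (2 * β - 1) / ((1 - 2 * β) * Real.Gamma (1 - β) ^ 2)) := by
    filter_upwards [ae_exists_mem_cell hm, ae_all_iff.2 hh,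
      ae_all_iff.2 fun n => Lp.coeFn_sub (h n) (g n),
      ae_all_iff.2 fun n => ae_sum_smul_eq hm hind fun j => γ * ⟪e n, C j⟫ / Real.sqrt m]
      with x ⟨j, hj⟩ hhx hsub hgx
    obtain ⟨K, hK, hKC⟩ := hC j x hj
    have hval (n : ℕ) : (h n - g n : L2) x = ⟪e n, γ • (K - C j)⟫ := by
      rw [hsub, Pi.sub_apply, hhx, hgx n j hj, hK, real_inner_smul_right, inner_sub_right,
        div_mul_cancel₀ _ (Real.sqrt_pos.2 hm').ne']
      ring
    simp_rw [hval]
    rw [e.tsum_enorm_inner_sq, enorm_sq_eq_ofReal_norm_sq]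
    refine ENNReal.ofReal_le_ofReal ?_
    rw [norm_smul, mul_pow, Real.norm_eq_abs, sq_abs, hγ, div_pow, one_pow, ← div_div,
      div_mul_eq_mul_div, one_mul]
    gcongr
  calc ∑' n, ‖h n - ∑ j, ⟪ind j, h n⟫ • ind j‖ₑ ^ 2
      ≤ ∑' n, ‖h n - g n‖ₑ ^ 2 := by
        refine ENNReal.tsum_le_tsum fun n => ?_
        gcongr
        rw [enorm_le_iff_norm_le]
        exact (orthonormal_of_ae_eq_cell hm hind).norm_sub_proj_le _ _
    _ = ∫⁻ x, ∑' n, ‖(h n - g n : L2) x‖ₑ ^ 2 ∂μ01 := by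
        simp_rw [L2_enorm_sq]
        rw [lintegral_tsum fun n => (Lp.aestronglyMeasurable _).enorm.pow_const 2]
    _ ≤ ∫⁻ _, ENNReal.ofReal
          ((m : ℝ) ^ (2 * β - 1) / ((1 - 2 * β) * Real.Gamma (1 - β) ^ 2)) ∂μ01 :=
        lintegral_mono_ae hpoint
    _ = _ := by simp

end StepApproximation

lemma summable_and_tsum_le_of_tsum_ofReal_le {ι : Type*} {a : ι → ℝ} {C : ℝ} (ha : ∀ i, 0 ≤ a i)
    (hC : 0 ≤ C) (h : ∑' i, ENNReal.ofReal (a i) ≤ ENNReal.ofReal C) :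
    Summable a ∧ ∑' i, a i ≤ C := by
  have hs : Summable a := by
    have := ENNReal.summable_toReal (h.trans_lt ENNReal.ofReal_lt_top).ne
    simpa only [ENNReal.toReal_ofReal (ha _)] using this
  refine ⟨hs, ?_⟩
  rwa [← ENNReal.ofReal_tsum_of_nonneg ha hs, ENNReal.ofReal_le_ofReal_iff hC] at h

theorem projection_covariance_trace_bound
    (β : ℝ) (hβ0 : 0 < β) (hβ : β < 1 / 2)
    (m : ℕ) (hm : 1 ≤ m)
    (e : HilbertBasis ℕ ℝ L2)
    -- h n = h_n^{1−β} = I^{1−β}_{1^-}(e_n)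
    (h : ℕ → L2)
    (hh : ∀ n, ∀ᵐ x ∂μ01, h n x = Ifrac β ((e n : L2) : ℝ → ℝ) x)
    -- the orthonormal family e^m_j = √m·𝟙_{[j/m,(j+1)/m)}, 0 ≤ j ≤ m−1
    (ind : Fin m → L2)
    (hind : ∀ j, ∀ᵐ s ∂μ01,
      ind j s = if s ∈ Set.Ico ((j:ℝ)/m) (((j:ℝ)+1)/m) then Real.sqrt m else 0)
    -- p = p_{F_m}, the orthogonal projection onto F_m = span{e^m_j : 0 ≤ j ≤ m−1}
    (p : L2 →L[ℝ] L2)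
    (hp : ∀ f : L2, p f = ∑ j, ⟪ind j, f⟫ • ind j)
    -- the operator Σ_{n,k}(⟨p h_n, p h_k⟩ − ⟨h_n, h_k⟩)x_n⊗x_k on l²(ℕ)
    (Td : l2 →L[ℝ] l2)
    (hTd : ∀ n k : ℕ, ⟪Td (xb k), xb n⟫ = ⟪p (h n), p (h k)⟫ - ⟪h n, h k⟫) :
    (∑' n, ‖h n - p (h n)‖ ^ 2
        ≤ (m:ℝ) ^ (2*β - 1) / ((1 - 2*β) * Real.Gamma (1 - β) ^ 2)) ∧
    traceNormE Td
        ≤ ENNReal.ofReal ((m:ℝ) ^ (2*β - 1) / ((1 - 2*β) * Real.Gamma (1 - β) ^ 2)) := by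
  have hcell (j : Fin m) : ind j =ᵐ[μ01] (cell m j).indicator fun _ => Real.sqrt m := by
    filter_upwards [hind j] with s hs
    rw [hs, cell, Set.indicator_apply]
  have hbound := tsum_enorm_sub_proj_le hβ0 hβ hm e h hh hcell
  simp_rw [← hp] at hbound
  have hC : 0 ≤ (m:ℝ) ^ (2*β - 1) / ((1 - 2*β) * Real.Gamma (1 - β) ^ 2) :=
    div_nonneg (by positivity) (mul_nonneg (by linarith) (by positivity))
  obtain ⟨hsum, hle⟩ := summable_and_tsum_le_of_tsum_ofReal_le
    (a := fun n => ‖h n - p (h n)‖ ^ 2) (fun _ => by positivity) hC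
    (by simpa only [enorm_sq_eq_ofReal_norm_sq] using hbound)
  refine ⟨hle, traceNormE_le_of_gram e _ hbound hsum Td fun n k => ?_⟩
  rw [hTd]
  simp_rw [hp]
  exact (orthonormal_of_ae_eq_cell hm hcell).inner_proj_proj_sub _ _
end
end
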